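/- Let n ≥ 1 and c₁ > 0. There exist constants θ₀ ∈ (0, π/2), c₀ > 1 and r₀ > 0, depending only on n and c₁, with the following property. Let h : ℝⁿ → ℝⁿ be of class C⁵ on the closed unit ball B̄_n(0,1) with h(0) = 0, Dh(0) = 0 and ‖h‖_{C⁵(B̄_n(0,1))} ≤ c₁. Then for every p ∈ ℂⁿ with 0 < |p| < r₀ there exist a map f : 𝔻̄ → ℂⁿ and a point ζ ∈ 𝔻 such that: f is holomorphic on 𝔻 and of class C¹ on 𝔻̄ with ‖f‖_{C¹(𝔻̄)} ≤ c₀; f(e^{iθ}) ∈ {x + i h(x) : x ∈ (ℝ⁺)ⁿ ∩ B̄_n(0,1)} for every θ with |θ| ≤ θ₀; |f(1)| ≤ c₀ |p|; f(ζ) = p; and |1 − ζ| ≤ √(c₀ |p|). -/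

import Mathlib

open Metric Real

/-- The `C^k` norm of `g` on a set `s`: the supremum over `s` of the norms of
the iterated derivatives (within `s`) of `g` of all orders up to `k`. -/
noncomputable def CkNormOn {E F : Type*} [NormedAddCommGroup E] [NormedSpace ℝ E]
    [NormedAddCommGroup F] [NormedSpace ℝ F] (k : ℕ) (s : Set E) (g : E → F) : ℝ :=
  ⨆ p : s × Fin (k + 1), ‖iteratedFDerivWithin ℝ (p.2 : ℕ) g s (p.1 : E)‖

set_option linter.unusedSectionVars false

section trig
variable {E : Type*} [NormedAddCommGroup E] [InnerProductSpace ℝ E]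

/-- Finite vector-valued trigonometric sum. -/
noncomputable def trigS (p q : ℕ → E) (N : ℕ) (t : ℝ) : E :=
  ∑ k ∈ Finset.range N, (cos (((k : ℝ) + 1) * t) • p k + sin (((k : ℝ) + 1) * t) • q k)

/-- Cosine coefficient. -/
noncomputable def cosC (y : ℝ → E) (k : ℕ) : E :=
  (π)⁻¹ • ∫ t in (0 : ℝ)..(2 * π), cos (((k : ℝ) + 1) * t) • y t

/-- Sine coefficient. -/
noncomputable def sinC (y : ℝ → E) (k : ℕ) : E :=
  (π)⁻¹ • ∫ t in (0 : ℝ)..(2 * π), sin (((k : ℝ) + 1) * t) • y t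

lemma trigS_continuous (p q : ℕ → E) (N : ℕ) : Continuous (trigS p q N) := by
  unfold trigS; fun_prop

lemma trigS_hasDerivAt (p q : ℕ → E) (N : ℕ) (t : ℝ) :
    HasDerivAt (trigS p q N)
      (trigS (fun k => ((k : ℝ) + 1) • q k) (fun k => -(((k : ℝ) + 1) • p k)) N t) t := by
  unfold trigS
  apply HasDerivAt.fun_sum
  intro k _
  have h1 : HasDerivAt (fun t : ℝ => ((k : ℝ) + 1) * t) ((k : ℝ) + 1) t := by
    simpa using (hasDerivAt_id t).const_mul ((k : ℝ) + 1)
  have h2 := (h1.cos.smul_const (p k)).add (h1.sin.smul_const (q k))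
  refine h2.congr_deriv ?_
  module

lemma trigS_periodic (p q : ℕ → E) (N : ℕ) : Function.Periodic (trigS p q N) (2 * π) := by
  intro t
  unfold trigS
  apply Finset.sum_congr rfl
  intro k _
  have : ((k : ℝ) + 1) * (t + 2 * π) = ((k : ℝ) + 1) * t + ((k + 1 : ℕ) : ℝ) * (2 * π) := by
    push_cast; ring
  rw [this, cos_add_nat_mul_two_pi, sin_add_nat_mul_two_pi]

lemma int_cos_eq_zero (m : ℤ) (hm : m ≠ 0) : ∫ t in (0 : ℝ)..(2 * π), cos ((m : ℝ) * t) = 0 := by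
  have hm' : (m : ℝ) ≠ 0 := by exact_mod_cast hm
  rw [intervalIntegral.integral_comp_mul_left _ hm']
  have := Real.sin_int_mul_pi (2 * m)
  push_cast at this
  simp [show (m : ℝ) * (2 * π) = 2 * m * π by ring, this]

lemma int_sin_eq_zero (m : ℤ) : ∫ t in (0 : ℝ)..(2 * π), sin ((m : ℝ) * t) = 0 := by
  by_cases hm : m = 0
  · simp [hm]
  have hm' : (m : ℝ) ≠ 0 := by exact_mod_cast hm
  rw [intervalIntegral.integral_comp_mul_left _ hm']
  have := Real.cos_int_mul_two_pi m
  simp [this]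

lemma int_cos_cos (k l : ℕ) : ∫ t in (0 : ℝ)..(2 * π),
    cos (((k : ℝ) + 1) * t) * cos (((l : ℝ) + 1) * t) = if k = l then π else 0 := by
  have h1 : ∀ t : ℝ, cos (((k : ℝ) + 1) * t) * cos (((l : ℝ) + 1) * t) =
      (1 / 2) * cos ((((k : ℤ) - l : ℤ) : ℝ) * t) + (1 / 2) * cos ((((k : ℤ) + l + 2 : ℤ) : ℝ) * t) := by
    intro t
    have e1 : ((((k : ℤ) - l : ℤ) : ℝ) * t) = ((k : ℝ) + 1) * t - ((l : ℝ) + 1) * t := by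
      push_cast; ring
    have e2 : ((((k : ℤ) + l + 2 : ℤ) : ℝ) * t) = ((k : ℝ) + 1) * t + ((l : ℝ) + 1) * t := by
      push_cast; ring
    rw [e1, e2, cos_add, cos_sub]; ring
  simp_rw [h1]
  rw [intervalIntegral.integral_add (by apply Continuous.intervalIntegrable; fun_prop)
    (by apply Continuous.intervalIntegrable; fun_prop), intervalIntegral.integral_const_mul,
    intervalIntegral.integral_const_mul, int_cos_eq_zero ((k : ℤ) + l + 2) (by positivity)]
  split_ifs with h
  · subst h; simp
  · rw [int_cos_eq_zero]
    · simp
    · omega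

lemma int_sin_sin (k l : ℕ) : ∫ t in (0 : ℝ)..(2 * π),
    sin (((k : ℝ) + 1) * t) * sin (((l : ℝ) + 1) * t) = if k = l then π else 0 := by
  have h1 : ∀ t : ℝ, sin (((k : ℝ) + 1) * t) * sin (((l : ℝ) + 1) * t) =
      (1 / 2) * cos ((((k : ℤ) - l : ℤ) : ℝ) * t) - (1 / 2) * cos ((((k : ℤ) + l + 2 : ℤ) : ℝ) * t) := by
    intro t
    have e1 : ((((k : ℤ) - l : ℤ) : ℝ) * t) = ((k : ℝ) + 1) * t - ((l : ℝ) + 1) * t := by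
      push_cast; ring
    have e2 : ((((k : ℤ) + l + 2 : ℤ) : ℝ) * t) = ((k : ℝ) + 1) * t + ((l : ℝ) + 1) * t := by
      push_cast; ring
    rw [e1, e2, cos_add, cos_sub]; ring
  simp_rw [h1]
  rw [intervalIntegral.integral_sub (by apply Continuous.intervalIntegrable; fun_prop)
    (by apply Continuous.intervalIntegrable; fun_prop), intervalIntegral.integral_const_mul,
    intervalIntegral.integral_const_mul, int_cos_eq_zero ((k : ℤ) + l + 2) (by positivity)]
  split_ifs with h
  · subst h; simp
  · rw [int_cos_eq_zero]
    · simp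
    · omega

lemma int_sin_cos (k l : ℕ) : ∫ t in (0 : ℝ)..(2 * π),
    sin (((k : ℝ) + 1) * t) * cos (((l : ℝ) + 1) * t) = 0 := by
  have h1 : ∀ t : ℝ, sin (((k : ℝ) + 1) * t) * cos (((l : ℝ) + 1) * t) =
      (1 / 2) * sin ((((k : ℤ) - l : ℤ) : ℝ) * t) + (1 / 2) * sin ((((k : ℤ) + l + 2 : ℤ) : ℝ) * t) := by
    intro t
    have e1 : ((((k : ℤ) - l : ℤ) : ℝ) * t) = ((k : ℝ) + 1) * t - ((l : ℝ) + 1) * t := by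
      push_cast; ring
    have e2 : ((((k : ℤ) + l + 2 : ℤ) : ℝ) * t) = ((k : ℝ) + 1) * t + ((l : ℝ) + 1) * t := by
      push_cast; ring
    rw [e1, e2, sin_add, sin_sub]; ring
  simp_rw [h1]
  rw [intervalIntegral.integral_add (by apply Continuous.intervalIntegrable; fun_prop)
    (by apply Continuous.intervalIntegrable; fun_prop), intervalIntegral.integral_const_mul,
    intervalIntegral.integral_const_mul, int_sin_eq_zero, int_sin_eq_zero]
  simp

variable [CompleteSpace E]

lemma inner_cosC (y : ℝ → E) (hy : Continuous y) (k : ℕ) (v : E) :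
    inner ℝ v (cosC y k) = (π)⁻¹ * ∫ t in (0 : ℝ)..(2 * π), cos (((k : ℝ) + 1) * t) * inner ℝ v (y t) := by
  unfold cosC
  rw [inner_smul_right]
  congr 1
  have := (innerSL ℝ v).intervalIntegral_comp_comm (a := 0) (b := 2 * π) (μ := MeasureTheory.volume)
    (f := fun t => cos (((k : ℝ) + 1) * t) • y t)
    (by apply Continuous.intervalIntegrable; fun_prop)
  simp only [innerSL_apply_apply, inner_smul_right] at this
  exact this.symm

lemma inner_sinC (y : ℝ → E) (hy : Continuous y) (k : ℕ) (v : E) :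
    inner ℝ v (sinC y k) = (π)⁻¹ * ∫ t in (0 : ℝ)..(2 * π), sin (((k : ℝ) + 1) * t) * inner ℝ v (y t) := by
  unfold sinC
  rw [inner_smul_right]
  congr 1
  have := (innerSL ℝ v).intervalIntegral_comp_comm (a := 0) (b := 2 * π) (μ := MeasureTheory.volume)
    (f := fun t => sin (((k : ℝ) + 1) * t) • y t)
    (by apply Continuous.intervalIntegrable; fun_prop)
  simp only [innerSL_apply_apply, inner_smul_right] at this
  exact this.symm

lemma int_inner_trigS (y : ℝ → E) (hy : Continuous y) (p q : ℕ → E) (N : ℕ) :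
    ∫ t in (0 : ℝ)..(2 * π), inner ℝ (trigS p q N t) (y t) =
      π * ∑ k ∈ Finset.range N, (inner ℝ (p k) (cosC y k) + inner ℝ (q k) (sinC y k)) := by
  unfold trigS
  simp_rw [sum_inner, inner_add_left, inner_smul_left]
  rw [intervalIntegral.integral_finsetSum
    (fun i _ => by apply Continuous.intervalIntegrable; simp; fun_prop), Finset.mul_sum]
  apply Finset.sum_congr rfl
  intro k _
  rw [intervalIntegral.integral_add (by apply Continuous.intervalIntegrable; simp; fun_prop)
    (by apply Continuous.intervalIntegrable; simp; fun_prop), inner_cosC y hy, inner_sinC y hy]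
  have := pi_ne_zero
  simp only [conj_trivial]
  field_simp

lemma cosC_trigS (p q : ℕ → E) (N k : ℕ) :
    cosC (trigS p q N) k = if k < N then p k else 0 := by
  unfold cosC trigS
  simp_rw [Finset.smul_sum, smul_add, smul_smul]
  rw [intervalIntegral.integral_finsetSum
    (fun i _ => by apply Continuous.intervalIntegrable; fun_prop)]
  have : ∀ i ∈ Finset.range N, ∫ t in (0 : ℝ)..(2 * π),
     ((cos (((k : ℝ) + 1) * t) * cos (((i : ℝ) + 1) * t)) • p i +
      (cos (((k : ℝ) + 1) * t) * sin (((i : ℝ) + 1) * t)) • q i) = if k = i then π • p i else 0 := by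
    intro i _
    rw [intervalIntegral.integral_add (by apply Continuous.intervalIntegrable; fun_prop)
      (by apply Continuous.intervalIntegrable; fun_prop), intervalIntegral.integral_smul_const,
      intervalIntegral.integral_smul_const, int_cos_cos]
    have := int_sin_cos i k
    simp_rw [mul_comm (sin _)] at this
    rw [this]
    split_ifs <;> simp
  rw [Finset.sum_congr rfl this]
  simp only [Finset.sum_ite_eq, Finset.mem_range]
  split_ifs
  · rw [smul_smul, inv_mul_cancel₀ pi_ne_zero, one_smul]
  · simp

lemma sinC_trigS (p q : ℕ → E) (N k : ℕ) :
    sinC (trigS p q N) k = if k < N then q k else 0 := by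
  unfold sinC trigS
  simp_rw [Finset.smul_sum, smul_add, smul_smul]
  rw [intervalIntegral.integral_finsetSum
    (fun i _ => by apply Continuous.intervalIntegrable; fun_prop)]
  have : ∀ i ∈ Finset.range N, ∫ t in (0 : ℝ)..(2 * π),
     ((sin (((k : ℝ) + 1) * t) * cos (((i : ℝ) + 1) * t)) • p i +
      (sin (((k : ℝ) + 1) * t) * sin (((i : ℝ) + 1) * t)) • q i) = if k = i then π • q i else 0 := by
    intro i _
    rw [intervalIntegral.integral_add (by apply Continuous.intervalIntegrable; fun_prop)
      (by apply Continuous.intervalIntegrable; fun_prop), intervalIntegral.integral_smul_const,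
      intervalIntegral.integral_smul_const, int_sin_sin, int_sin_cos]
    split_ifs <;> simp
  rw [Finset.sum_congr rfl this]
  simp only [Finset.sum_ite_eq, Finset.mem_range]
  split_ifs
  · rw [smul_smul, inv_mul_cancel₀ pi_ne_zero, one_smul]
  · simp

lemma int_norm_sq_trigS (p q : ℕ → E) (N : ℕ) :
    ∫ t in (0 : ℝ)..(2 * π), ‖trigS p q N t‖ ^ 2 =
      π * ∑ k ∈ Finset.range N, (‖p k‖ ^ 2 + ‖q k‖ ^ 2) := by
  have := int_inner_trigS (trigS p q N) (trigS_continuous p q N) p q N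
  simp_rw [real_inner_self_eq_norm_sq] at this
  rw [this]
  congr 1
  apply Finset.sum_congr rfl
  intro k hk
  rw [cosC_trigS, sinC_trigS, if_pos (Finset.mem_range.1 hk), if_pos (Finset.mem_range.1 hk),
    real_inner_self_eq_norm_sq, real_inner_self_eq_norm_sq]

lemma bessel (y : ℝ → E) (hy : Continuous y) (N : ℕ) :
    π * ∑ k ∈ Finset.range N, (‖cosC y k‖ ^ 2 + ‖sinC y k‖ ^ 2) ≤
      ∫ t in (0 : ℝ)..(2 * π), ‖y t‖ ^ 2 := by
  have hS := trigS_continuous (cosC y) (sinC y) N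
  have h0 : 0 ≤ ∫ t in (0 : ℝ)..(2 * π), ‖y t - trigS (cosC y) (sinC y) N t‖ ^ 2 :=
    intervalIntegral.integral_nonneg (by positivity) (fun t _ => by positivity)
  have h1 : ∀ t, ‖y t - trigS (cosC y) (sinC y) N t‖ ^ 2 =
      ‖y t‖ ^ 2 - 2 * inner ℝ (trigS (cosC y) (sinC y) N t) (y t)
       + ‖trigS (cosC y) (sinC y) N t‖ ^ 2 := by
    intro t; rw [norm_sub_sq_real, real_inner_comm]
  simp_rw [h1] at h0
  rw [intervalIntegral.integral_add (by apply Continuous.intervalIntegrable; fun_prop)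
    (by apply Continuous.intervalIntegrable; fun_prop),
    intervalIntegral.integral_sub (by apply Continuous.intervalIntegrable; fun_prop)
    (by apply Continuous.intervalIntegrable; fun_prop), intervalIntegral.integral_const_mul,
    int_norm_sq_trigS, int_inner_trigS y hy] at h0
  simp_rw [real_inner_self_eq_norm_sq] at h0
  linarith

lemma sinC_deriv2 (y y1 y2 : ℝ → E) (h1 : ∀ t, HasDerivAt y (y1 t) t)
    (h2 : ∀ t, HasDerivAt y1 (y2 t) t) (hc : Continuous y2)
    (hp : Function.Periodic y (2 * π)) (hp1 : Function.Periodic y1 (2 * π)) (k : ℕ) :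
    sinC y2 k = -(((k : ℝ) + 1) ^ 2 • sinC y k) ∧ cosC y2 k = -(((k : ℝ) + 1) ^ 2 • cosC y k) := by
  have hy : Continuous y := continuous_iff_continuousAt.2 fun t => (h1 t).continuousAt
  have hl : ∀ t, HasDerivAt (fun t : ℝ => ((k : ℝ) + 1) * t) ((k : ℝ) + 1) t := fun t => by
    simpa using (hasDerivAt_id t).const_mul ((k : ℝ) + 1)
  have e0 : y (2 * π) = y 0 := by simpa using hp 0
  have e1 : y1 (2 * π) = y1 0 := by simpa using hp1 0
  have es : sin (((k : ℝ) + 1) * (2 * π)) = 0 := by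
    simpa using sin_add_nat_mul_two_pi 0 (k + 1)
  have ec : cos (((k : ℝ) + 1) * (2 * π)) = 1 := by
    simpa using cos_add_nat_mul_two_pi 0 (k + 1)
  constructor
  · have hd : ∀ t, HasDerivAt (fun t => sin (((k : ℝ) + 1) * t) • y1 t
        - (((k : ℝ) + 1) * cos (((k : ℝ) + 1) * t)) • y t)
        (sin (((k : ℝ) + 1) * t) • y2 t + ((k : ℝ) + 1) ^ 2 • (sin (((k : ℝ) + 1) * t) • y t)) t := by
      intro t
      have := ((hl t).sin.smul (h2 t)).sub (((hl t).cos.const_mul ((k : ℝ) + 1)).smul (h1 t))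
      refine this.congr_deriv ?_
      module
    have := intervalIntegral.integral_eq_sub_of_hasDerivAt (a := 0) (b := 2 * π)
      (fun t _ => hd t) (by apply Continuous.intervalIntegrable; fun_prop)
    rw [intervalIntegral.integral_add (by apply Continuous.intervalIntegrable; fun_prop)
      (by apply Continuous.intervalIntegrable; fun_prop), intervalIntegral.integral_smul,
      es, ec, e0, e1] at this
    simp only [mul_zero, sin_zero, cos_zero, sub_self] at this
    unfold sinC
    rw [smul_comm, ← smul_neg, eq_neg_of_add_eq_zero_left this]
  · have hd : ∀ t, HasDerivAt (fun t => cos (((k : ℝ) + 1) * t) • y1 t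
        + (((k : ℝ) + 1) * sin (((k : ℝ) + 1) * t)) • y t)
        (cos (((k : ℝ) + 1) * t) • y2 t + ((k : ℝ) + 1) ^ 2 • (cos (((k : ℝ) + 1) * t) • y t)) t := by
      intro t
      have := ((hl t).cos.smul (h2 t)).add (((hl t).sin.const_mul ((k : ℝ) + 1)).smul (h1 t))
      refine this.congr_deriv ?_
      module
    have := intervalIntegral.integral_eq_sub_of_hasDerivAt (a := 0) (b := 2 * π)
      (fun t _ => hd t) (by apply Continuous.intervalIntegrable; fun_prop)
    rw [intervalIntegral.integral_add (by apply Continuous.intervalIntegrable; fun_prop)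
      (by apply Continuous.intervalIntegrable; fun_prop), intervalIntegral.integral_smul,
      es, ec, e0, e1] at this
    simp only [mul_zero, sin_zero, cos_zero, sub_self] at this
    unfold cosC
    rw [smul_comm, ← smul_neg, eq_neg_of_add_eq_zero_left this]

lemma energy_deriv2 (y y1 y2 : ℝ → E) (h1 : ∀ t, HasDerivAt y (y1 t) t)
    (h2 : ∀ t, HasDerivAt y1 (y2 t) t) (hc : Continuous y2)
    (hp : Function.Periodic y (2 * π)) (hp1 : Function.Periodic y1 (2 * π)) (N : ℕ) :
    π * ∑ k ∈ Finset.range N, ((k : ℝ) + 1) ^ 4 * (‖cosC y k‖ ^ 2 + ‖sinC y k‖ ^ 2) ≤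
      ∫ t in (0 : ℝ)..(2 * π), ‖y2 t‖ ^ 2 := by
  refine le_trans (le_of_eq ?_) (bessel y2 hc N)
  congr 1
  apply Finset.sum_congr rfl
  intro k _
  obtain ⟨e1, e2⟩ := sinC_deriv2 y y1 y2 h1 h2 hc hp hp1 k
  rw [e1, e2, norm_neg, norm_neg, norm_smul, norm_smul, norm_of_nonneg (by positivity)]
  ring

/-- sup bound from energy -/
lemma sum_le_of_energy (p q : ℕ → E) (N : ℕ) (M : ℝ) (hM : 0 ≤ M)
    (h : ∑ k ∈ Finset.range N, ((k : ℝ) + 1) ^ 4 * (‖p k‖ ^ 2 + ‖q k‖ ^ 2) ≤ M ^ 2) :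
    ∑ k ∈ Finset.range N, ((k : ℝ) + 1) * (‖p k‖ + ‖q k‖) ≤ 2 * M := by
  have hs : ∀ N : ℕ, ∑ k ∈ Finset.range (N + 1), (((k : ℝ) + 1)⁻¹) ^ 2 ≤ 2 - 1 / ((N : ℝ) + 1)  := by
    intro N
    induction N with
    | zero => norm_num
    | succ N ih =>
      rw [Finset.sum_range_succ]
      have : (((N : ℝ) + 1 + 1)⁻¹) ^ 2 ≤ 1 / ((N : ℝ) + 1) - 1 / ((N : ℝ) + 1 + 1) := by
        rw [div_sub_div _ _ (by positivity) (by positivity), inv_pow, inv_eq_one_div,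
          div_le_div_iff₀ (by positivity) (by positivity)]
        nlinarith [Nat.cast_nonneg (α := ℝ) N]
      push_cast
      linarith
  have hs2 : ∑ k ∈ Finset.range N, (((k : ℝ) + 1)⁻¹) ^ 2 ≤ 2 := by
    have h1 := hs N
    rw [Finset.sum_range_succ] at h1
    have h2 : 0 ≤ (((N : ℝ) + 1)⁻¹) ^ 2 := by positivity
    linarith [show (0:ℝ) < 1 / ((N : ℝ) + 1) by positivity]
  have cs := Finset.sum_mul_sq_le_sq_mul_sq (Finset.range N) (fun k : ℕ => (((k : ℝ) + 1)⁻¹))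
    (fun k => ((k : ℝ) + 1) ^ 2 * (‖p k‖ + ‖q k‖))
  have e : ∑ k ∈ Finset.range N, (((k : ℝ) + 1)⁻¹) * (((k : ℝ) + 1) ^ 2 * (‖p k‖ + ‖q k‖)) =
      ∑ k ∈ Finset.range N, ((k : ℝ) + 1) * (‖p k‖ + ‖q k‖) := by
    apply Finset.sum_congr rfl
    intro k _
    field_simp
  rw [e] at cs
  have h3 : ∑ k ∈ Finset.range N, (((k : ℝ) + 1) ^ 2 * (‖p k‖ + ‖q k‖)) ^ 2 ≤ 2 * M ^ 2 := by
    refine le_trans ?_ (mul_le_mul_of_nonneg_left h (by norm_num : (0:ℝ) ≤ 2))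
    rw [Finset.mul_sum]
    apply Finset.sum_le_sum
    intro k _
    have : 0 ≤ ((k : ℝ) + 1) ^ 4 * (‖p k‖ - ‖q k‖) ^ 2 := by positivity
    nlinarith
  refine abs_le_of_sq_le_sq' ?_ (by positivity) |>.2
  calc _ ≤ _ := cs
    _ ≤ 2 * (2 * M ^ 2) := by
      apply mul_le_mul hs2 h3 (Finset.sum_nonneg fun _ _ => by positivity) (by norm_num)
    _ = (2 * M) ^ 2 := by ring

lemma trigS_norm_le (p q : ℕ → E) (N : ℕ) (t : ℝ) :
    ‖trigS p q N t‖ ≤ ∑ k ∈ Finset.range N, (‖p k‖ + ‖q k‖) := by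
  unfold trigS
  refine (norm_sum_le _ _).trans (Finset.sum_le_sum fun k _ => ?_)
  refine (norm_add_le _ _).trans ?_
  rw [norm_smul, norm_smul]
  apply add_le_add
  · exact mul_le_of_le_one_left (norm_nonneg _) (abs_cos_le_one _)
  · exact mul_le_of_le_one_left (norm_nonneg _) (abs_sin_le_one _)

end trig

lemma fourier_inversion_real (y : ℝ → ℝ) (hy : Continuous y) (hp : Function.Periodic y (2 * π))
    (hs : Summable fun k => ‖cosC y k‖ + ‖sinC y k‖) (t : ℝ) :
    HasSum (fun k : ℕ => cos (((k : ℝ) + 1) * t) * cosC y k + sin (((k : ℝ) + 1) * t) * sinC y k)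
      (y t - (2 * π)⁻¹ * ∫ s in (0 : ℝ)..(2 * π), y s) := by
  have : Fact (0 < 2 * π) := ⟨by positivity⟩
  have hpc : Function.Periodic (fun t => (y t : ℂ)) (2 * π) := fun t => by simp [hp t]
  have hcont : Continuous (hpc.lift : AddCircle (2 * π) → ℂ) := by
    apply continuous_coinduced_dom.mpr
    show Continuous (fun t => (y t : ℂ))
    fun_prop
  let F : C(AddCircle (2 * π), ℂ) := ⟨hpc.lift, hcont⟩
  have hF : ∀ s : ℝ, F (s : AddCircle (2 * π)) = y s := fun s => hpc.lift_coe s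
  have hco : ∀ (n : ℤ), fourierCoeff F n = (2 * π : ℂ)⁻¹ *
     ((∫ s in (0 : ℝ)..(2 * π), cos (n * s) * y s : ℝ) -
      Complex.I * (∫ s in (0 : ℝ)..(2 * π), sin (n * s) * y s : ℝ)) := by
    intro n
    rw [fourierCoeff_eq_intervalIntegral _ _ 0, zero_add]
    have : ∀ s : ℝ, fourier (-n) (s : AddCircle (2 * π)) • F (s : AddCircle (2 * π)) =
        ((cos (n * s) * y s : ℝ) : ℂ) - Complex.I * ((sin (n * s) * y s : ℝ) : ℂ) := by
      intro s
      rw [hF, fourier_coe_apply]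
      have : 2 * (π : ℂ) * Complex.I * ((-n : ℤ) : ℂ) * s / ((2 * π : ℝ) : ℂ) =
         (((-(n * s) : ℝ)) : ℂ) * Complex.I := by
        have : (π : ℂ) ≠ 0 := by exact_mod_cast pi_ne_zero
        push_cast
        field_simp
      rw [this, Complex.exp_mul_I, ← Complex.ofReal_cos, ← Complex.ofReal_sin, cos_neg, sin_neg]
      push_cast
      simp only [smul_eq_mul]
      ring
    simp_rw [this]
    rw [intervalIntegral.integral_sub (by apply Continuous.intervalIntegrable; fun_prop)
      (by apply Continuous.intervalIntegrable; fun_prop), intervalIntegral.integral_const_mul,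
      intervalIntegral.integral_ofReal, intervalIntegral.integral_ofReal, Complex.real_smul]
    push_cast
    rw [one_div]
  have hpi : (π : ℂ) ≠ 0 := by exact_mod_cast pi_ne_zero
  have hpos : ∀ k : ℕ, fourierCoeff F ((k : ℤ) + 1) = ((cosC y k : ℝ) - Complex.I * (sinC y k : ℝ)) / 2 := by
    intro k
    rw [hco]
    unfold cosC sinC
    simp only [smul_eq_mul]
    push_cast
    field_simp
  have hneg : ∀ k : ℕ, fourierCoeff F (-((k : ℤ) + 1)) = ((cosC y k : ℝ) + Complex.I * (sinC y k : ℝ)) / 2 := by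
    intro k
    rw [hco]
    unfold cosC sinC
    have e : ∀ s : ℝ, ((-((k : ℤ) + 1) : ℤ) : ℝ) * s = -(((k : ℝ) + 1) * s) := by
      intro s; push_cast; ring
    simp_rw [e, cos_neg, sin_neg, neg_mul]
    rw [intervalIntegral.integral_neg]
    simp only [smul_eq_mul]
    push_cast
    field_simp
    ring
  have hsum : Summable (fourierCoeff F) := by
    apply Summable.of_add_one_of_neg_add_one
    · refine Summable.of_norm_bounded hs (fun k => ?_)
      rw [hpos, norm_div, Complex.norm_ofNat]
      have := norm_sub_le ((cosC y k : ℝ) : ℂ) (Complex.I * (sinC y k : ℝ))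
      rw [norm_mul, Complex.norm_I, Complex.norm_real, Complex.norm_real] at this
      linarith [norm_nonneg (cosC y k), norm_nonneg (sinC y k)]
    · refine Summable.of_norm_bounded hs (fun k => ?_)
      rw [hneg, norm_div, Complex.norm_ofNat]
      have := norm_add_le ((cosC y k : ℝ) : ℂ) (Complex.I * (sinC y k : ℝ))
      rw [norm_mul, Complex.norm_I, Complex.norm_real, Complex.norm_real] at this
      linarith [norm_nonneg (cosC y k), norm_nonneg (sinC y k)]
  have hfin := (has_pointwise_sum_fourier_series_of_summable hsum (t : AddCircle (2 * π))).nat_add_neg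
  have h2 := (hasSum_nat_add_iff' 1).2 hfin
  rw [hF] at h2
  rw [← Complex.hasSum_ofReal]
  convert! h2 using 1
  · ext k
    have e1 : ((k + 1 : ℕ) : ℤ) = (k : ℤ) + 1 := by push_cast; ring
    rw [e1, hpos, hneg, fourier_coe_apply, fourier_coe_apply]
    have f1 : 2 * (π : ℂ) * Complex.I * (((k : ℤ) + 1 : ℤ) : ℂ) * t / ((2 * π : ℝ) : ℂ) =
         (((((k : ℝ) + 1) * t : ℝ)) : ℂ) * Complex.I := by
      push_cast
      field_simp
    have f2 : 2 * (π : ℂ) * Complex.I * ((-((k : ℤ) + 1) : ℤ) : ℂ) * t / ((2 * π : ℝ) : ℂ) =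
         (((-(((k : ℝ) + 1) * t) : ℝ)) : ℂ) * Complex.I := by
      push_cast
      field_simp
    rw [f1, f2, Complex.exp_mul_I, Complex.exp_mul_I, ← Complex.ofReal_cos, ← Complex.ofReal_sin,
      ← Complex.ofReal_cos, ← Complex.ofReal_sin, cos_neg, sin_neg]
    push_cast
    simp only [smul_eq_mul]
    ring_nf
    rw [Complex.I_sq]
    ring
  · have h0 := hco 0
    simp only [Int.cast_zero, zero_mul, cos_zero, sin_zero, one_mul,
      intervalIntegral.integral_zero, Complex.ofReal_zero, mul_zero, sub_zero] at h0
    simp [h0]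

section vec
variable {E : Type*} [NormedAddCommGroup E] [InnerProductSpace ℝ E] [CompleteSpace E]

lemma fourier_inversion (y : ℝ → E) (hy : Continuous y) (hp : Function.Periodic y (2 * π))
    (hs : Summable fun k => ‖cosC y k‖ + ‖sinC y k‖) (t : ℝ) :
    HasSum (fun k : ℕ => cos (((k : ℝ) + 1) * t) • cosC y k + sin (((k : ℝ) + 1) * t) • sinC y k)
      (y t - (2 * π)⁻¹ • ∫ s in (0 : ℝ)..(2 * π), y s) := by
  have hsum : Summable (fun k : ℕ => cos (((k : ℝ) + 1) * t) • cosC y k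
      + sin (((k : ℝ) + 1) * t) • sinC y k) := by
    refine Summable.of_norm_bounded hs (fun k => ?_)
    refine (norm_add_le _ _).trans ?_
    rw [norm_smul, norm_smul]
    apply add_le_add
    · exact mul_le_of_le_one_left (norm_nonneg _) (abs_cos_le_one _)
    · exact mul_le_of_le_one_left (norm_nonneg _) (abs_sin_le_one _)
  have key : ∑' k : ℕ, (cos (((k : ℝ) + 1) * t) • cosC y k + sin (((k : ℝ) + 1) * t) • sinC y k)
      = y t - (2 * π)⁻¹ • ∫ s in (0 : ℝ)..(2 * π), y s := by
    apply ext_inner_left ℝ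
    intro v
    have hc : ∀ k, cosC (fun t => inner ℝ v (y t)) k = inner ℝ v (cosC y k) := by
      intro k; rw [inner_cosC y hy]; simp [cosC]
    have hs' : ∀ k, sinC (fun t => inner ℝ v (y t)) k = inner ℝ v (sinC y k) := by
      intro k; rw [inner_sinC y hy]; simp [sinC]
    have h1 := fourier_inversion_real (fun t => inner ℝ v (y t)) (by fun_prop)
      (fun t => by simp [hp t]) (by
        refine Summable.of_nonneg_of_le (fun k => by positivity) (fun k => ?_) (hs.mul_left ‖v‖)
        rw [hc, hs', mul_add]
        exact add_le_add (norm_inner_le_norm _ _) (norm_inner_le_norm _ _)) t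
    have h2 := (innerSL ℝ v).hasSum hsum.hasSum
    simp only [hc, hs'] at h1
    simp only [innerSL_apply_apply, inner_add_right, inner_smul_right] at h2
    rw [h2.unique h1, inner_sub_right, inner_smul_right]
    congr 2
    have := (innerSL ℝ v).intervalIntegral_comp_comm (a := 0) (b := 2 * π)
      (μ := MeasureTheory.volume) (f := y) (hy.intervalIntegrable _ _)
    simpa using this
  rw [← key]
  exact hsum.hasSum
end vec

section curve
variable {E : Type*} [NormedAddCommGroup E] [InnerProductSpace ℝ E]

/-- The properties of the graphing function that are used. -/
structure HF (h : E → E) (Dh : E → E →L[ℝ] E) (D2 : E → E →L[ℝ] E →L[ℝ] E) (K : ℝ) : Prop where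
  hK : 0 < K
  d1 : ∀ x ∈ ball (0 : E) 1, HasFDerivAt h (Dh x) x
  d2 : ∀ x ∈ ball (0 : E) 1, HasFDerivAt Dh (D2 x) x
  b2 : ∀ x ∈ ball (0 : E) 1, ‖D2 x‖ ≤ K
  c2 : ContinuousOn D2 (ball (0 : E) 1)
  h0 : h 0 = 0
  D0 : Dh 0 = 0

variable {h : E → E} {Dh : E → E →L[ℝ] E} {D2 : E → E →L[ℝ] E →L[ℝ] E} {K : ℝ}

lemma HF.norm_Dh_le (H : HF h Dh D2 K) {x : E} (hx : ‖x‖ < 1) : ‖Dh x‖ ≤ K * ‖x‖ := by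
  have := (convex_ball (0 : E) 1).norm_image_sub_le_of_norm_hasFDerivWithin_le
    (f := Dh) (f' := D2) (C := K) (x := 0) (y := x)
    (fun x hx => (H.d2 x hx).hasFDerivWithinAt) H.b2 (by simp) (by simpa using hx)
  simpa [H.D0] using this

lemma HF.lip (H : HF h Dh D2 K) {x y : E} {r : ℝ} (hr : r < 1) (hx : ‖x‖ ≤ r) (hy : ‖y‖ ≤ r) :
    ‖h x - h y‖ ≤ K * r * ‖x - y‖ := by
  refine (convex_closedBall (0 : E) r).norm_image_sub_le_of_norm_hasFDerivWithin_le
    (f := h) (f' := Dh) (fun x hx => ?_) (fun x hx => ?_) (by simpa using hy) (by simpa using hx)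
  · exact (H.d1 x (by simp at hx ⊢; linarith)).hasFDerivWithinAt
  · simp at hx
    exact (H.norm_Dh_le (by linarith)).trans (mul_le_mul_of_nonneg_left hx H.hK.le)

lemma HF.norm_h_le (H : HF h Dh D2 K) {x : E} (hx : ‖x‖ < 1) : ‖h x‖ ≤ K * ‖x‖ ^ 2 := by
  have := H.lip hx le_rfl (y := 0) (by simp)
  rw [H.h0, sub_zero, sub_zero] at this
  linarith

/-- the base curve -/
noncomputable def xC (a b : E) (τ : ℝ) (σ : ℝ → ℝ) (U : ℝ → E) (t : ℝ) : E :=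
  a + σ t • b + (σ t ^ 2 + τ ^ 2) • U t

/-- the normalized imaginary part -/
noncomputable def yC (h : E → E) (a b : E) (τ : ℝ) (σ : ℝ → ℝ) (U : ℝ → E) (t : ℝ) : E :=
  (σ t ^ 2 + τ ^ 2)⁻¹ • h (xC a b τ σ U t)

lemma xC_norm_le {a b : E} {τ ρ : ℝ} {σ : ℝ → ℝ} {U : ℝ → E} {t : ℝ} (hτ : 0 < τ)
    (hU : ‖U t‖ ≤ ρ) (ha : ‖a‖ ≤ ρ * τ ^ 2) (hb : ‖b‖ ≤ ρ * τ) :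
    ‖xC a b τ σ U t‖ ≤ 3 * ρ * (σ t ^ 2 + τ ^ 2) := by
  have hρ : 0 ≤ ρ := (norm_nonneg _).trans hU
  unfold xC
  have h1 : ‖σ t • b‖ ≤ |σ t| * (ρ * τ) := by
    rw [norm_smul]; exact mul_le_mul_of_nonneg_left hb (abs_nonneg _)
  have h2 : ‖(σ t ^ 2 + τ ^ 2) • U t‖ ≤ (σ t ^ 2 + τ ^ 2) * ρ := by
    rw [norm_smul, norm_of_nonneg (by positivity)]
    exact mul_le_mul_of_nonneg_left hU (by positivity)
  have h3 : |σ t| * τ ≤ σ t ^ 2 + τ ^ 2 := by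
    have := sq_nonneg (|σ t| - τ)
    nlinarith [sq_abs (σ t), sq_nonneg (|σ t| + τ)]
  have h4 := mul_le_mul_of_nonneg_left h3 hρ
  have h5 : 0 ≤ ρ * σ t ^ 2 := by positivity
  calc _ ≤ ‖a‖ + ‖σ t • b‖ + ‖(σ t ^ 2 + τ ^ 2) • U t‖ := norm_add₃_le
    _ ≤ _ := by nlinarith

lemma Q_le {τ C s : ℝ} (hτ : 0 < τ) (hτC : τ ≤ C) (hs : |s| ≤ C) : s ^ 2 + τ ^ 2 ≤ 2 * C ^ 2 := by
  have : s ^ 2 ≤ C ^ 2 := by rw [← sq_abs]; gcongr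
  have : τ ^ 2 ≤ C ^ 2 := by gcongr
  linarith

lemma xC_small {a b : E} {τ ρ C : ℝ} {σ : ℝ → ℝ} {U : ℝ → E} {t : ℝ} (hτ : 0 < τ) (hτC : τ ≤ C)
    (hs : |σ t| ≤ C) (hρC : 6 * ρ * C ^ 2 ≤ 1 / 2)
    (hU : ‖U t‖ ≤ ρ) (ha : ‖a‖ ≤ ρ * τ ^ 2) (hb : ‖b‖ ≤ ρ * τ) :
    3 * ρ * (σ t ^ 2 + τ ^ 2) ≤ 1 / 2 ∧ ‖xC a b τ σ U t‖ ≤ 1 / 2 := by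
  have hρ : 0 ≤ ρ := (norm_nonneg _).trans hU
  have h1 := xC_norm_le (σ := σ) hτ hU ha hb
  have h2 := mul_le_mul_of_nonneg_left (Q_le hτ hτC hs) (by positivity : 0 ≤ 3 * ρ)
  constructor <;> linarith

lemma yC_lip (H : HF h Dh D2 K) {a b : E} {τ ρ C : ℝ} {σ : ℝ → ℝ} {U W : ℝ → E} {t : ℝ}
    (hτ : 0 < τ) (hτC : τ ≤ C)
    (hs : |σ t| ≤ C) (hρC : 6 * ρ * C ^ 2 ≤ 1 / 2)
    (hU : ‖U t‖ ≤ ρ) (hW : ‖W t‖ ≤ ρ) (ha : ‖a‖ ≤ ρ * τ ^ 2) (hb : ‖b‖ ≤ ρ * τ) :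
    ‖yC h a b τ σ U t - yC h a b τ σ W t‖ ≤ 6 * K * C ^ 2 * ρ * ‖U t - W t‖ := by
  have hρ : 0 ≤ ρ := (norm_nonneg _).trans hU
  have hK := H.hK
  have h1 := xC_norm_le (σ := σ) hτ hU ha hb
  have h1' := xC_norm_le (σ := σ) hτ hW ha hb
  have hQ := Q_le hτ hτC hs
  obtain ⟨h2, -⟩ := xC_small (σ := σ) hτ hτC hs hρC hU ha hb
  have h3 := H.lip (by linarith) h1 h1'
  have h4 : xC a b τ σ U t - xC a b τ σ W t = (σ t ^ 2 + τ ^ 2) • (U t - W t) := by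
    unfold xC; module
  have hQ0 : 0 < σ t ^ 2 + τ ^ 2 := by positivity
  set Q := σ t ^ 2 + τ ^ 2 with hQdef
  rw [h4, norm_smul, norm_of_nonneg hQ0.le] at h3
  unfold yC
  rw [← smul_sub, norm_smul, norm_inv, norm_of_nonneg hQ0.le]
  calc Q⁻¹ * _ ≤ Q⁻¹ * (K * (3 * ρ * Q) * (Q * ‖U t - W t‖)) := by gcongr
    _ = 3 * K * ρ * ‖U t - W t‖ * Q := by field_simp
    _ ≤ 3 * K * ρ * ‖U t - W t‖ * (2 * C ^ 2) := by gcongr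
    _ = _ := by ring

lemma yC_bound (H : HF h Dh D2 K) {a b : E} {τ ρ C : ℝ} {σ : ℝ → ℝ} {U : ℝ → E} {t : ℝ}
    (hτ : 0 < τ) (hτC : τ ≤ C)
    (hs : |σ t| ≤ C) (hρC : 6 * ρ * C ^ 2 ≤ 1 / 2)
    (hU : ‖U t‖ ≤ ρ) (ha : ‖a‖ ≤ ρ * τ ^ 2) (hb : ‖b‖ ≤ ρ * τ) :
    ‖yC h a b τ σ U t‖ ≤ 18 * K * C ^ 2 * ρ ^ 2 := by
  have hρ : 0 ≤ ρ := (norm_nonneg _).trans hU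
  have hK := H.hK
  have h1 := xC_norm_le (σ := σ) hτ hU ha hb
  have hQ := Q_le hτ hτC hs
  obtain ⟨h2, h2'⟩ := xC_small (σ := σ) hτ hτC hs hρC hU ha hb
  have h3 := H.norm_h_le (x := xC a b τ σ U t) (by linarith)
  have hQ0 : 0 < σ t ^ 2 + τ ^ 2 := by positivity
  unfold yC
  set Q := σ t ^ 2 + τ ^ 2 with hQdef
  rw [norm_smul, norm_inv, norm_of_nonneg hQ0.le]
  calc Q⁻¹ * _ ≤ Q⁻¹ * (K * (3 * ρ * Q) ^ 2) := by
        gcongr; exact h3.trans (by gcongr)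
    _ = 9 * K * ρ ^ 2 * Q := by field_simp; ring
    _ ≤ 9 * K * ρ ^ 2 * (2 * C ^ 2) := by gcongr
    _ = _ := by ring

set_option maxHeartbeats 1000000 in
lemma yC_deriv (H : HF h Dh D2 K) {a b : E} {τ ρ C : ℝ} {σ σ1 σ2 : ℝ → ℝ} {U U1 U2 : ℝ → E}
    (hτ : 0 < τ) (hτC : τ ≤ C)
    (hs : ∀ t, |σ t| ≤ C) (hs1 : ∀ t, |σ1 t| ≤ C) (hs2 : ∀ t, |σ2 t| ≤ C)
    (hσ : ∀ t, HasDerivAt σ (σ1 t) t) (hσ1 : ∀ t, HasDerivAt σ1 (σ2 t) t) (hσ2 : Continuous σ2)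
    (hρC : 6 * ρ * C ^ 2 ≤ 1 / 2)
    (hU : ∀ t, ‖U t‖ ≤ ρ) (hU1 : ∀ t, ‖U1 t‖ ≤ ρ) (hdU : ∀ t, HasDerivAt U (U1 t) t)
    (hdU1 : ∀ t, HasDerivAt U1 (U2 t) t) (hU2 : Continuous U2)
    (ha : ‖a‖ ≤ ρ * τ ^ 2) (hb : ‖b‖ ≤ ρ * τ) :
    ∃ y1 y2 : ℝ → E, (∀ t, HasDerivAt (yC h a b τ σ U) (y1 t) t) ∧ (∀ t, HasDerivAt y1 (y2 t) t) ∧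
      Continuous y2 ∧ ∀ t, ‖y2 t‖ ≤ 232 * K * C ^ 2 * ρ ^ 2 + 232 * K * C ^ 2 * ρ * ‖U2 t‖ := by
  have hρ : 0 ≤ ρ := (norm_nonneg _).trans (hU 0)
  have hK := H.hK
  have hC : 0 < C := by linarith
  have cσ : Continuous σ := continuous_iff_continuousAt.2 fun t => (hσ t).continuousAt
  have cσ1 : Continuous σ1 := continuous_iff_continuousAt.2 fun t => (hσ1 t).continuousAt
  have cU : Continuous U := continuous_iff_continuousAt.2 fun t => (hdU t).continuousAt
  have cU1 : Continuous U1 := continuous_iff_continuousAt.2 fun t => (hdU1 t).continuousAt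
  set Q : ℝ → ℝ := fun t => σ t ^ 2 + τ ^ 2 with hQ
  set Q1 : ℝ → ℝ := fun t => 2 * σ t * σ1 t with hQ1
  set Q2 : ℝ → ℝ := fun t => 2 * σ1 t ^ 2 + 2 * σ t * σ2 t with hQ2
  have Q0 : ∀ t, 0 < Q t := fun t => by simp only [hQ]; positivity
  have dQ : ∀ t, HasDerivAt Q (Q1 t) t := fun t => by
    have := ((hσ t).pow 2).add_const (τ ^ 2)
    refine this.congr_deriv ?_
    simp [hQ1]
  have dQ1 : ∀ t, HasDerivAt Q1 (Q2 t) t := fun t => by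
    have := ((hσ t).const_mul 2).mul (hσ1 t)
    refine this.congr_deriv ?_
    simp only [hQ2]; ring
  set x : ℝ → E := xC a b τ σ U with hx
  set x1 : ℝ → E := fun t => σ1 t • b + (Q1 t • U t + Q t • U1 t) with hx1
  set x2 : ℝ → E := fun t => σ2 t • b + (Q2 t • U t + (2 * Q1 t) • U1 t + Q t • U2 t) with hx2
  have dx : ∀ t, HasDerivAt x (x1 t) t := fun t => by
    have := (((hσ t).smul_const b).const_add a).add ((dQ t).smul (hdU t))
    refine this.congr_deriv ?_
    simp only [hx1]; module
  have dx1 : ∀ t, HasDerivAt x1 (x2 t) t := fun t => by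
    have := ((hσ1 t).smul_const b).add (((dQ1 t).smul (hdU t)).add ((dQ t).smul (hdU1 t)))
    refine this.congr_deriv ?_
    simp only [hx2]; module
  set R1 : ℝ → ℝ := fun t => -Q1 t / Q t ^ 2 with hR1
  set R2 : ℝ → ℝ := fun t => -Q2 t / Q t ^ 2 + 2 * Q1 t ^ 2 / Q t ^ 3 with hR2
  have dR : ∀ t, HasDerivAt (fun t => (Q t)⁻¹) (R1 t) t := fun t =>
    (dQ t).fun_inv (Q0 t).ne'
  have dR1 : ∀ t, HasDerivAt R1 (R2 t) t := fun t => by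
    have := (dQ1 t).neg.div ((dQ t).pow 2) (pow_ne_zero 2 (Q0 t).ne')
    refine this.congr_deriv ?_
    have := (Q0 t).ne'
    simp only [hR2, Pi.neg_apply, Pi.pow_apply]
    field_simp
    push_cast
    ring
  have xs : ∀ t, ‖x t‖ ≤ 1 / 2 := fun t => (xC_small hτ hτC (hs t) hρC (hU t) ha hb).2
  have xb : ∀ t, x t ∈ ball (0 : E) 1 := fun t => by
    simp; linarith [xs t]
  have dh : ∀ t, HasDerivAt (fun t => h (x t)) (Dh (x t) (x1 t)) t := fun t =>
    (H.d1 _ (xb t)).comp_hasDerivAt t (dx t)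
  have dDh : ∀ t, HasDerivAt (fun t => Dh (x t)) (D2 (x t) (x1 t)) t := fun t =>
    (H.d2 _ (xb t)).comp_hasDerivAt t (dx t)
  have dDhx : ∀ t, HasDerivAt (fun t => Dh (x t) (x1 t))
      (D2 (x t) (x1 t) (x1 t) + Dh (x t) (x2 t)) t := fun t =>
    (dDh t).clm_apply (dx1 t)
  have cx : Continuous x := continuous_iff_continuousAt.2 fun t => (dx t).continuousAt
  have cDh : Continuous (fun t => Dh (x t)) := continuous_iff_continuousAt.2 fun t => (dDh t).continuousAt
  have ch : Continuous (fun t => h (x t)) := continuous_iff_continuousAt.2 fun t => (dh t).continuousAt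
  have cD2 : Continuous (fun t => D2 (x t)) := by
    rw [← continuousOn_univ]
    exact H.c2.comp cx.continuousOn (fun t _ => xb t)
  have cQ : Continuous Q := by fun_prop
  have cQ1 : Continuous Q1 := by fun_prop
  have cQ2 : Continuous Q2 := by fun_prop
  have cR1 : Continuous R1 := continuous_iff_continuousAt.2 fun t => (dR1 t).continuousAt
  have cR : Continuous (fun t => (Q t)⁻¹) := continuous_iff_continuousAt.2 fun t => (dR t).continuousAt
  have cR2 : Continuous R2 := by
    have h2 : ∀ t, Q t ^ 2 ≠ 0 := fun t => pow_ne_zero 2 (Q0 t).ne'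
    have h3 : ∀ t, Q t ^ 3 ≠ 0 := fun t => pow_ne_zero 3 (Q0 t).ne'
    exact (cQ2.neg.div (cQ.pow 2) h2).add ((continuous_const.mul (cQ1.pow 2)).div (cQ.pow 3) h3)
  refine ⟨fun t => R1 t • h (x t) + (Q t)⁻¹ • Dh (x t) (x1 t),
    fun t => R2 t • h (x t) + (2 * R1 t) • Dh (x t) (x1 t)
      + (Q t)⁻¹ • (D2 (x t) (x1 t) (x1 t) + Dh (x t) (x2 t)), fun t => ?_, fun t => ?_, ?_, fun t => ?_⟩
  · have := (dR t).smul (dh t)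
    refine this.congr_deriv ?_
    module
  · have := ((dR1 t).smul (dh t)).add ((dR t).smul (dDhx t))
    refine this.congr_deriv ?_
    module
  · have cx1 : Continuous x1 := by fun_prop
    have cx2 : Continuous x2 := by fun_prop
    exact ((cR2.smul ch).add ((continuous_const.mul cR1).smul (cDh.clm_apply cx1))).add
      (cR.smul (((cD2.clm_apply cx1).clm_apply cx1).add (cDh.clm_apply cx2)))
  · -- estimate
    have hx3 : ‖x t‖ ≤ 3 * ρ * Q t := xC_norm_le hτ (hU t) ha hb
    have hQC : Q t ≤ 2 * C ^ 2 := Q_le hτ hτC (hs t)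
    have hxs := xs t
    have n0 : ‖h (x t)‖ ≤ K * ‖x t‖ ^ 2 := H.norm_h_le (by linarith)
    have n1 : ‖Dh (x t)‖ ≤ K * ‖x t‖ := H.norm_Dh_le (by linarith)
    have n2 : ‖D2 (x t)‖ ≤ K := H.b2 _ (xb t)
    obtain ⟨q, q0, hq⟩ : ∃ q : ℝ, 0 < q ∧ Q t = q ^ 2 :=
      ⟨√(Q t), Real.sqrt_pos.2 (Q0 t), (Real.sq_sqrt (Q0 t).le).symm⟩
    have q1 : |σ t| ≤ q := by
      apply abs_le_of_sq_le_sq _ q0.le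
      rw [← hq]; simp only [hQ]; nlinarith
    have q2 : τ ≤ q := by
      apply le_of_sq_le_sq _ q0.le
      rw [← hq]; simp only [hQ]; nlinarith [sq_nonneg (σ t)]
    have q3 : q ≤ 2 * C := by
      apply le_of_sq_le_sq _ (by positivity)
      rw [← hq]; nlinarith
    have e1 : |Q1 t| ≤ 2 * C * q := by
      simp only [hQ1, abs_mul, abs_two]
      calc 2 * |σ t| * |σ1 t| ≤ 2 * q * C := by gcongr; exact hs1 t
        _ = _ := by ring
    have e2 : |Q2 t| ≤ 4 * C ^ 2 := by
      simp only [hQ2]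
      refine (abs_add_le _ _).trans ?_
      simp only [abs_mul, abs_two, abs_pow]
      calc 2 * |σ1 t| ^ 2 + 2 * |σ t| * |σ2 t| ≤ 2 * C ^ 2 + 2 * C * C := by
            gcongr
            exacts [hs1 t, hs t, hs2 t]
        _ = _ := by ring
    have m1 : ‖x1 t‖ ≤ 5 * C * ρ * q := by
      simp only [hx1]
      calc _ ≤ ‖σ1 t • b‖ + (‖Q1 t • U t‖ + ‖Q t • U1 t‖) :=
            (norm_add_le _ _).trans (add_le_add le_rfl (norm_add_le _ _))
        _ = |σ1 t| * ‖b‖ + (|Q1 t| * ‖U t‖ + q ^ 2 * ‖U1 t‖) := by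
            simp only [norm_smul, Real.norm_eq_abs]
            rw [hq, abs_of_nonneg (by positivity : 0 ≤ q ^ 2)]
        _ ≤ C * (ρ * q) + (2 * C * q * ρ + (q * (2 * C)) * ρ) := by
            gcongr
            · exact hs1 t
            · exact hb.trans (by gcongr)
            · exact hU t
            · rw [sq]; gcongr
            · exact hU1 t
        _ = _ := by ring
    have m2 : ‖x2 t‖ ≤ 13 * C ^ 2 * ρ + q ^ 2 * ‖U2 t‖ := by
      simp only [hx2]
      calc _ ≤ ‖σ2 t • b‖ + (‖Q2 t • U t‖ + ‖(2 * Q1 t) • U1 t‖ + ‖Q t • U2 t‖) :=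
            (norm_add_le _ _).trans (add_le_add le_rfl norm_add₃_le)
        _ = |σ2 t| * ‖b‖ + (|Q2 t| * ‖U t‖ + 2 * |Q1 t| * ‖U1 t‖ + q ^ 2 * ‖U2 t‖) := by
            simp only [norm_smul, Real.norm_eq_abs, abs_mul, abs_two]
            rw [hq, abs_of_nonneg (by positivity : 0 ≤ q ^ 2)]
        _ ≤ C * (ρ * C) + (4 * C ^ 2 * ρ + 2 * (2 * C * (2 * C)) * ρ + q ^ 2 * ‖U2 t‖) := by
            gcongr
            · exact hs2 t
            · exact hb.trans (by gcongr)
            · exact hU t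
            · exact e1.trans (by gcongr)
            · exact hU1 t
        _ = _ := by ring
    have r1 : |R1 t| ≤ 2 * C / q ^ 3 := by
      simp only [hR1, hq, abs_div, abs_neg]
      rw [abs_of_nonneg (by positivity : 0 ≤ (q ^ 2) ^ 2)]
      calc |Q1 t| / (q ^ 2) ^ 2 ≤ (2 * C * q) / (q ^ 2) ^ 2 := by gcongr
        _ = _ := by field_simp
    have r2 : |R2 t| ≤ 12 * C ^ 2 / q ^ 4 := by
      simp only [hR2, hq]
      refine (abs_add_le _ _).trans ?_
      simp only [abs_div, abs_neg, abs_mul, abs_two, abs_pow, abs_of_pos q0]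
      calc |Q2 t| / (q ^ 2) ^ 2 + 2 * |Q1 t| ^ 2 / (q ^ 2) ^ 3
          ≤ (4 * C ^ 2) / (q ^ 2) ^ 2 + 2 * (2 * C * q) ^ 2 / (q ^ 2) ^ 3 := by gcongr
        _ = _ := by field_simp; ring
    rw [hq] at hx3 hQC
    have T0 : ‖R2 t • h (x t)‖ ≤ 108 * K * C ^ 2 * ρ ^ 2 := by
      rw [norm_smul]
      calc _ ≤ 12 * C ^ 2 / q ^ 4 * (K * (3 * ρ * q ^ 2) ^ 2) := by
            gcongr
            · exact r2
            · exact n0.trans (by gcongr)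
        _ = _ := by field_simp; ring
    have T1 : ‖(2 * R1 t) • Dh (x t) (x1 t)‖ ≤ 60 * K * C ^ 2 * ρ ^ 2 := by
      rw [norm_smul, norm_mul]
      calc _ ≤ ‖(2 : ℝ)‖ * ‖R1 t‖ * (‖Dh (x t)‖ * ‖x1 t‖) := by
            gcongr; exact ContinuousLinearMap.le_opNorm _ _
        _ ≤ 2 * (2 * C / q ^ 3) * ((K * (3 * ρ * q ^ 2)) * (5 * C * ρ * q)) := by
            gcongr
            · simp
            · exact r1
            · exact n1.trans (by gcongr)
        _ = _ := by field_simp; ring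
    have T2 : ‖(Q t)⁻¹ • (D2 (x t) (x1 t) (x1 t) + Dh (x t) (x2 t))‖ ≤
        64 * K * C ^ 2 * ρ ^ 2 + 3 * K * ρ * q ^ 2 * ‖U2 t‖ := by
      rw [norm_smul, hq, norm_of_nonneg (by positivity)]
      calc _ ≤ (q ^ 2)⁻¹ * (‖D2 (x t)‖ * ‖x1 t‖ * ‖x1 t‖ + ‖Dh (x t)‖ * ‖x2 t‖) := by
            gcongr
            refine (norm_add_le _ _).trans (add_le_add ?_ ?_)
            · exact ContinuousLinearMap.le_opNorm₂ _ _ _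
            · exact ContinuousLinearMap.le_opNorm _ _
        _ ≤ (q ^ 2)⁻¹ * (K * (5 * C * ρ * q) * (5 * C * ρ * q) +
             (K * (3 * ρ * q ^ 2)) * (13 * C ^ 2 * ρ + q ^ 2 * ‖U2 t‖)) := by
            gcongr
            exact n1.trans (by gcongr)
        _ = _ := by field_simp; ring
    have T3 : 3 * K * ρ * q ^ 2 * ‖U2 t‖ ≤ 3 * K * ρ * (2 * C ^ 2) * ‖U2 t‖ := by gcongr
    have T4 : 0 ≤ K * ρ * C ^ 2 * ‖U2 t‖ := by positivity
    refine norm_add₃_le.trans ?_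
    linarith

end curve

section bishop
variable {E : Type*} [NormedAddCommGroup E] [InnerProductSpace ℝ E]

/-- All the data and smallness conditions for the Bishop equation. -/
structure BD (h : E → E) (Dh : E → E →L[ℝ] E) (D2 : E → E →L[ℝ] E →L[ℝ] E) (K : ℝ)
    (a b e : E) (τ ρ C M : ℝ) (σ σ1 σ2 : ℝ → ℝ) : Prop where
  H : HF h Dh D2 K
  hτ : 0 < τ
  hτC : τ ≤ C
  hs : ∀ t, |σ t| ≤ C
  hs1 : ∀ t, |σ1 t| ≤ C
  hs2 : ∀ t, |σ2 t| ≤ C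
  hσ : ∀ t, HasDerivAt σ (σ1 t) t
  hσ1 : ∀ t, HasDerivAt σ1 (σ2 t) t
  hσ2 : Continuous σ2
  per : Function.Periodic σ (2 * π)
  hρC : 6 * ρ * C ^ 2 ≤ 1 / 2
  ha : ‖a‖ ≤ ρ * τ ^ 2
  hb : ‖b‖ ≤ ρ * τ
  he : ‖e‖ ≤ ρ / 2
  hM : 0 < M
  hMρ : 4 * M ≤ ρ
  hA : 8 * (232 * K * C ^ 2) ^ 2 * ρ ^ 4 ≤ M ^ 2

variable {h : E → E} {Dh : E → E →L[ℝ] E} {D2 : E → E →L[ℝ] E →L[ℝ] E} {K : ℝ}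
  {a b e : E} {τ ρ C M : ℝ} {σ σ1 σ2 : ℝ → ℝ}

lemma periodic_deriv {F : Type*} [NormedAddCommGroup F] [NormedSpace ℝ F] {y y1 : ℝ → F} {c : ℝ}
    (h1 : ∀ t, HasDerivAt y (y1 t) t)
    (hp : Function.Periodic y c) : Function.Periodic y1 c := by
  intro t
  have h2 : HasDerivAt (fun s => y (s + c)) (y1 (t + c)) t := (h1 (t + c)).comp_add_const t c
  have h3 : (fun s => y (s + c)) = y := funext hp
  rw [h3] at h2
  exact h2.unique (h1 t)

lemma energy_coeff {p q : ℕ → E} (hM : 0 ≤ M)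
    (hE : ∀ N, ∑ k ∈ Finset.range N, ((k : ℝ) + 1) ^ 4 * (‖p k‖ ^ 2 + ‖q k‖ ^ 2) ≤ M ^ 2) (k : ℕ) :
    ‖p k‖ ≤ M / ((k : ℝ) + 1) ^ 2 ∧ ‖q k‖ ≤ M / ((k : ℝ) + 1) ^ 2 ∧
    ‖p k‖ ^ 2 + ‖q k‖ ^ 2 ≤ M ^ 2 / ((k : ℝ) + 1) ^ 4 := by
  have h1 := hE (k + 1)
  rw [Finset.sum_range_succ] at h1
  have h2 : 0 ≤ ∑ k ∈ Finset.range k, ((k : ℝ) + 1) ^ 4 * (‖p k‖ ^ 2 + ‖q k‖ ^ 2) :=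
    Finset.sum_nonneg fun _ _ => by positivity
  have h3 : ((k : ℝ) + 1) ^ 4 * (‖p k‖ ^ 2 + ‖q k‖ ^ 2) ≤ M ^ 2 := by linarith
  have h4 : (0 : ℝ) < ((k : ℝ) + 1) ^ 4 := by positivity
  refine ⟨?_, ?_, ?_⟩
  · rw [le_div_iff₀ (by positivity)]
    apply le_of_sq_le_sq _ hM |> fun h => h
    nlinarith [mul_nonneg h4.le (sq_nonneg ‖q k‖)]
  · rw [le_div_iff₀ (by positivity)]
    apply le_of_sq_le_sq _ hM |> fun h => h
    nlinarith [mul_nonneg h4.le (sq_nonneg ‖p k‖)]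
  · rw [le_div_iff₀ h4]; linarith

variable [CompleteSpace E]

lemma BD.hρ (B : BD h Dh D2 K a b e τ ρ C M σ σ1 σ2) : 0 < ρ := by linarith [B.hM, B.hMρ]

lemma BD.small (B : BD h Dh D2 K a b e τ ρ C M σ σ1 σ2) :
    (232 * K * C ^ 2 * ρ) ^ 2 ≤ 1 / 128 := by
  have h1 := B.hA
  have h2 : M ^ 2 ≤ (ρ / 4) ^ 2 := by
    have := B.hM; have := B.hMρ; gcongr; linarith
  have h3 : (232 * K * C ^ 2 * ρ) ^ 2 * ρ ^ 2 ≤ 1 / 128 * ρ ^ 2 := by nlinarith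
  exact le_of_mul_le_mul_right h3 (by have := B.hρ; positivity)

/-- bounds for a trigonometric polynomial with energy at most `M ^ 2` -/
lemma BD.U_bounds (B : BD h Dh D2 K a b e τ ρ C M σ σ1 σ2) {p q : ℕ → E} {N : ℕ}
    (hE : ∑ k ∈ Finset.range N, ((k : ℝ) + 1) ^ 4 * (‖p k‖ ^ 2 + ‖q k‖ ^ 2) ≤ M ^ 2) (t : ℝ) :
    ‖e + trigS p q N t‖ ≤ ρ ∧
    ‖trigS (fun k => ((k : ℝ) + 1) • q k) (fun k => -(((k : ℝ) + 1) • p k)) N t‖ ≤ ρ := by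
  have h1 := sum_le_of_energy p q N M B.hM.le hE
  have h2 := trigS_norm_le p q N t
  have h3 := trigS_norm_le (fun k => ((k : ℝ) + 1) • q k) (fun k => -(((k : ℝ) + 1) • p k)) N t
  have h4 : ∑ k ∈ Finset.range N, (‖p k‖ + ‖q k‖) ≤
      ∑ k ∈ Finset.range N, ((k : ℝ) + 1) * (‖p k‖ + ‖q k‖) := by
    refine Finset.sum_le_sum fun k _ => ?_
    have : (0 : ℝ) ≤ k := by positivity
    nlinarith [norm_nonneg (p k), norm_nonneg (q k)]
  have h5 : ∑ k ∈ Finset.range N, (‖((k : ℝ) + 1) • q k‖ + ‖-(((k : ℝ) + 1) • p k)‖) =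
      ∑ k ∈ Finset.range N, ((k : ℝ) + 1) * (‖p k‖ + ‖q k‖) := by
    refine Finset.sum_congr rfl fun k _ => ?_
    rw [norm_neg, norm_smul, norm_smul, norm_of_nonneg (by positivity)]; ring
  have := norm_add_le e (trigS p q N t)
  have := B.he; have := B.hMρ; have := B.hM
  constructor <;> linarith

lemma yC_periodic {U : ℝ → E} (hσ : Function.Periodic σ (2 * π)) (hU : Function.Periodic U (2 * π)) :
    Function.Periodic (yC h a b τ σ U) (2 * π) := by
  intro t
  simp only [yC, xC, hσ t, hU t]

lemma BD.yC_cont (B : BD h Dh D2 K a b e τ ρ C M σ σ1 σ2) {U : ℝ → E} (hU : Continuous U)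
    (hb : ∀ t, ‖U t‖ ≤ ρ) : Continuous (yC h a b τ σ U) := by
  have cσ : Continuous σ := continuous_iff_continuousAt.2 fun t => (B.hσ t).continuousAt
  have hτ := B.hτ
  have hx : Continuous (xC a b τ σ U) := by unfold xC; fun_prop
  have hh : ContinuousOn h (ball 0 1) := fun x hx => (B.H.d1 x hx).continuousAt.continuousWithinAt
  have h1 : Continuous fun t => h (xC a b τ σ U t) := by
    refine hh.comp_continuous hx fun t => ?_
    have := (xC_small (σ := σ) B.hτ B.hτC (B.hs t) B.hρC (hb t) B.ha B.hb).2
    simp; linarith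
  unfold yC
  refine Continuous.smul (Continuous.inv₀ (by fun_prop) fun t => by positivity) h1

lemma BD.step (B : BD h Dh D2 K a b e τ ρ C M σ σ1 σ2) {p q : ℕ → E} {N : ℕ}
    (hE : ∑ k ∈ Finset.range N, ((k : ℝ) + 1) ^ 4 * (‖p k‖ ^ 2 + ‖q k‖ ^ 2) ≤ M ^ 2) (N' : ℕ) :
    ∑ k ∈ Finset.range N', ((k : ℝ) + 1) ^ 4 *
      (‖cosC (yC h a b τ σ (fun t => e + trigS p q N t)) k‖ ^ 2 +
       ‖sinC (yC h a b τ σ (fun t => e + trigS p q N t)) k‖ ^ 2) ≤ M ^ 2 := by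
  set U : ℝ → E := fun t => e + trigS p q N t with hUdef
  set p1 : ℕ → E := fun k => ((k : ℝ) + 1) • q k
  set q1 : ℕ → E := fun k => -(((k : ℝ) + 1) • p k)
  set p2 : ℕ → E := fun k => ((k : ℝ) + 1) • q1 k with hp2
  set q2 : ℕ → E := fun k => -(((k : ℝ) + 1) • p1 k) with hq2
  have hb := B.U_bounds hE
  have hdU : ∀ t, HasDerivAt U (trigS p1 q1 N t) t := fun t => (trigS_hasDerivAt p q N t).const_add e
  obtain ⟨y1, y2, d1, d2, c2, bd⟩ := yC_deriv B.H B.hτ B.hτC B.hs B.hs1 B.hs2 B.hσ B.hσ1 B.hσ2 B.hρC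
    (U := U) (fun t => (hb t).1) (fun t => (hb t).2) hdU (trigS_hasDerivAt p1 q1 N)
    (trigS_continuous p2 q2 N) B.ha B.hb
  have hUp : Function.Periodic U (2 * π) := fun t => by simp only [hUdef, trigS_periodic p q N t]
  have hyp := yC_periodic (h := h) (a := a) (b := b) (τ := τ) B.per hUp
  have h1 := energy_deriv2 _ y1 y2 d1 d2 c2 hyp (periodic_deriv d1 hyp) N'
  set A := 232 * K * C ^ 2 with hA
  have h2 : ∫ t in (0 : ℝ)..(2 * π), ‖y2 t‖ ^ 2 ≤
      ∫ t in (0 : ℝ)..(2 * π), (2 * A ^ 2 * ρ ^ 4 + 2 * A ^ 2 * ρ ^ 2 * ‖trigS p2 q2 N t‖ ^ 2) := by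
    have := trigS_continuous p2 q2 N
    apply intervalIntegral.integral_mono_on (by positivity)
      (Continuous.intervalIntegrable (by fun_prop) _ _)
      (Continuous.intervalIntegrable (by fun_prop) _ _)
    intro t _
    calc ‖y2 t‖ ^ 2 ≤ (A * ρ ^ 2 + A * ρ * ‖trigS p2 q2 N t‖) ^ 2 := by gcongr; exact bd t
      _ ≤ _ := by nlinarith [sq_nonneg (A * ρ ^ 2 - A * ρ * ‖trigS p2 q2 N t‖)]
  have h3 : ∫ t in (0 : ℝ)..(2 * π), (2 * A ^ 2 * ρ ^ 4 + 2 * A ^ 2 * ρ ^ 2 * ‖trigS p2 q2 N t‖ ^ 2) =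
      2 * π * (2 * A ^ 2 * ρ ^ 4) + 2 * A ^ 2 * ρ ^ 2 *
        (π * ∑ k ∈ Finset.range N, (‖p2 k‖ ^ 2 + ‖q2 k‖ ^ 2)) := by
    have := trigS_continuous p2 q2 N
    rw [intervalIntegral.integral_add (by simp) (Continuous.intervalIntegrable (by fun_prop) _ _),
      intervalIntegral.integral_const, intervalIntegral.integral_const_mul, int_norm_sq_trigS]
    simp
  have h4 : ∑ k ∈ Finset.range N, (‖p2 k‖ ^ 2 + ‖q2 k‖ ^ 2) ≤ M ^ 2 := by
    refine le_trans (le_of_eq ?_) hE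
    refine Finset.sum_congr rfl fun k _ => ?_
    simp only [hp2, hq2, p1, q1, norm_neg, norm_smul]
    rw [norm_of_nonneg (by positivity : (0 : ℝ) ≤ (k : ℝ) + 1)]; ring
  have h5 := B.small
  have h6 := B.hA
  rw [← hA] at h5 h6
  have hρ := B.hρ
  have h7 : 2 * A ^ 2 * ρ ^ 2 * (π * ∑ k ∈ Finset.range N, (‖p2 k‖ ^ 2 + ‖q2 k‖ ^ 2)) ≤
      2 * A ^ 2 * ρ ^ 2 * (π * M ^ 2) := by gcongr
  have h8 : 2 * A ^ 2 * ρ ^ 2 * (π * M ^ 2) ≤ π * (M ^ 2 / 2) := by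
    have : 0 ≤ π * M ^ 2 := by positivity
    nlinarith
  have h9 : 2 * π * (2 * A ^ 2 * ρ ^ 4) ≤ π * (M ^ 2 / 2) := by
    have := pi_pos
    nlinarith
  have : π * _ ≤ π * M ^ 2 := h1.trans (h2.trans (h3.le.trans (by linarith)))
  exact le_of_mul_le_mul_left this pi_pos

end bishop

section bishop2
variable {E : Type*} [NormedAddCommGroup E] [InnerProductSpace ℝ E]
variable {h : E → E} {Dh : E → E →L[ℝ] E} {D2 : E → E →L[ℝ] E →L[ℝ] E} {K : ℝ}
  {a b e : E} {τ ρ C M : ℝ} {σ σ1 σ2 : ℝ → ℝ}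

/-- Picard iterates -/
noncomputable def Uit (h : E → E) (a b e : E) (τ : ℝ) (σ : ℝ → ℝ) : ℕ → ℝ → E
  | 0 => fun _ => e
  | m + 1 => fun t => e + trigS (sinC (yC h a b τ σ (Uit h a b e τ σ m)))
      (fun k => -(cosC (yC h a b τ σ (Uit h a b e τ σ m)) k)) (m + 1) t

variable [CompleteSpace E]

lemma Uit_energy (B : BD h Dh D2 K a b e τ ρ C M σ σ1 σ2) (m N : ℕ) :
    ∑ k ∈ Finset.range N, ((k : ℝ) + 1) ^ 4 *
      (‖sinC (yC h a b τ σ (Uit h a b e τ σ m)) k‖ ^ 2 +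
       ‖cosC (yC h a b τ σ (Uit h a b e τ σ m)) k‖ ^ 2) ≤ M ^ 2 := by
  induction m generalizing N with
  | zero =>
    have := B.step (p := 0) (q := 0) (N := 0) (by simp; positivity) N
    simp only [trigS, Finset.range_zero, Finset.sum_empty, add_zero] at this
    simp only [add_comm (‖sinC _ _‖ ^ 2)]
    exact this
  | succ m ih =>
    have := B.step (p := sinC (yC h a b τ σ (Uit h a b e τ σ m)))
      (q := fun k => -(cosC (yC h a b τ σ (Uit h a b e τ σ m)) k)) (N := m + 1)
      (by simpa only [norm_neg] using ih (m + 1)) N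
    simp only [add_comm (‖sinC _ _‖ ^ 2)]
    exact this

lemma Uit_bound (B : BD h Dh D2 K a b e τ ρ C M σ σ1 σ2) (m : ℕ) (t : ℝ) :
    ‖Uit h a b e τ σ m t‖ ≤ ρ := by
  cases m with
  | zero => exact B.he.trans (by linarith [B.hρ])
  | succ m =>
    exact (B.U_bounds (q := fun k => -(cosC (yC h a b τ σ (Uit h a b e τ σ m)) k)) (N := m + 1)
      (by simpa only [norm_neg] using Uit_energy B m (m + 1)) t).1

lemma Uit_cont (m : ℕ) : Continuous (Uit h a b e τ σ m) := by
  cases m with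
  | zero => exact continuous_const
  | succ m => exact continuous_const.add (trigS_continuous _ _ _)

lemma sinC_sub {y z : ℝ → E} (hy : Continuous y) (hz : Continuous z) (k : ℕ) :
    sinC (fun t => y t - z t) k = sinC y k - sinC z k := by
  unfold sinC
  rw [← smul_sub, ← intervalIntegral.integral_sub (Continuous.intervalIntegrable (by fun_prop) _ _)
    (Continuous.intervalIntegrable (by fun_prop) _ _)]
  simp only [smul_sub]

lemma cosC_sub {y z : ℝ → E} (hy : Continuous y) (hz : Continuous z) (k : ℕ) :
    cosC (fun t => y t - z t) k = cosC y k - cosC z k := by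
  unfold cosC
  rw [← smul_sub, ← intervalIntegral.integral_sub (Continuous.intervalIntegrable (by fun_prop) _ _)
    (Continuous.intervalIntegrable (by fun_prop) _ _)]
  simp only [smul_sub]

/-- Lipschitz estimate on Fourier side -/
lemma BD.lipF (B : BD h Dh D2 K a b e τ ρ C M σ σ1 σ2) {U W : ℝ → E} (hU : Continuous U)
    (hW : Continuous W) (bU : ∀ t, ‖U t‖ ≤ ρ) (bW : ∀ t, ‖W t‖ ≤ ρ) {p q : ℕ → E} {N : ℕ}
    (hd : ∀ t, U t - W t = trigS p q N t) (N' : ℕ) :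
    ∑ k ∈ Finset.range N', (‖sinC (yC h a b τ σ U) k - sinC (yC h a b τ σ W) k‖ ^ 2 +
      ‖cosC (yC h a b τ σ U) k - cosC (yC h a b τ σ W) k‖ ^ 2) ≤
     1 / 128 * ∑ k ∈ Finset.range N, (‖p k‖ ^ 2 + ‖q k‖ ^ 2) := by
  have cU := B.yC_cont hU bU
  have cW := B.yC_cont hW bW
  have h1 := bessel (fun t => yC h a b τ σ U t - yC h a b τ σ W t) (cU.sub cW) N'
  simp only [sinC_sub cU cW, cosC_sub cU cW] at h1
  have h2 : ∫ t in (0 : ℝ)..(2 * π), ‖yC h a b τ σ U t - yC h a b τ σ W t‖ ^ 2 ≤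
      ∫ t in (0 : ℝ)..(2 * π), 1 / 128 * ‖trigS p q N t‖ ^ 2 := by
    have := trigS_continuous p q N
    apply intervalIntegral.integral_mono_on (by positivity)
      (Continuous.intervalIntegrable (by fun_prop) _ _)
      (Continuous.intervalIntegrable (by fun_prop) _ _)
    intro t _
    have h3 := yC_lip B.H B.hτ B.hτC (B.hs t) B.hρC (bU t) (bW t) B.ha B.hb
    rw [hd t] at h3
    have hs := B.small
    have hK := B.H.hK
    have hρ := B.hρ
    have h4 : 6 * K * C ^ 2 * ρ ≤ 232 * K * C ^ 2 * ρ := by gcongr; norm_num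
    calc _ ≤ (6 * K * C ^ 2 * ρ * ‖trigS p q N t‖) ^ 2 := by gcongr
      _ ≤ (232 * K * C ^ 2 * ρ * ‖trigS p q N t‖) ^ 2 := by gcongr
      _ = (232 * K * C ^ 2 * ρ) ^ 2 * ‖trigS p q N t‖ ^ 2 := by ring
      _ ≤ _ := by gcongr
  rw [intervalIntegral.integral_const_mul, int_norm_sq_trigS] at h2
  have h3 := h1.trans h2
  refine le_of_mul_le_mul_left (a := π) ?_ pi_pos
  simp only [add_comm (‖sinC _ _ - _‖ ^ 2)]
  linarith

lemma Uit_diff (B : BD h Dh D2 K a b e τ ρ C M σ σ1 σ2) (m N : ℕ) :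
    ∑ k ∈ Finset.range N, (‖sinC (yC h a b τ σ (Uit h a b e τ σ (m + 1))) k
        - sinC (yC h a b τ σ (Uit h a b e τ σ m)) k‖ ^ 2 +
      ‖cosC (yC h a b τ σ (Uit h a b e τ σ (m + 1))) k
        - cosC (yC h a b τ σ (Uit h a b e τ σ m)) k‖ ^ 2) ≤ M ^ 2 / ((m : ℝ) + 1) ^ 4 := by
  induction m generalizing N with
  | zero =>
    have h1 := B.lipF (Uit_cont 1) (Uit_cont 0) (Uit_bound B 1) (Uit_bound B 0)
      (p := sinC (yC h a b τ σ (Uit h a b e τ σ 0)))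
      (q := fun k => -(cosC (yC h a b τ σ (Uit h a b e τ σ 0)) k)) (N := 1)
      (fun t => by simp [Uit]) N
    refine h1.trans ?_
    have h2 := Uit_energy B 0 1
    simp only [Finset.sum_range_one, norm_neg] at h2 ⊢
    norm_num at h2 ⊢
    nlinarith [sq_nonneg M]
  | succ m ih =>
    set s : ℕ → ℕ → E := fun m k => sinC (yC h a b τ σ (Uit h a b e τ σ m)) k with hs
    set c : ℕ → ℕ → E := fun m k => cosC (yC h a b τ σ (Uit h a b e τ σ m)) k with hc
    have h1 := B.lipF (Uit_cont (m + 2)) (Uit_cont (m + 1)) (Uit_bound B (m + 2)) (Uit_bound B (m + 1))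
      (p := fun k => if k < m + 1 then s (m + 1) k - s m k else s (m + 1) k)
      (q := fun k => if k < m + 1 then -(c (m + 1) k - c m k) else -(c (m + 1) k)) (N := m + 2)
      (fun t => by
        have e1 : Uit h a b e τ σ (m + 2) t = e + trigS (s (m + 1)) (fun k => - (c (m + 1) k)) (m + 2) t := rfl
        have e2 : Uit h a b e τ σ (m + 1) t = e + trigS (s m) (fun k => - (c m k)) (m + 1) t := rfl
        rw [e1, e2]
        unfold trigS
        rw [Finset.sum_range_succ _ (m + 1), Finset.sum_range_succ _ (m + 1)]
        simp only [lt_irrefl, if_false]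
        rw [add_sub_add_left_eq_sub, add_sub_right_comm, ← Finset.sum_sub_distrib]
        congr 1
        refine Finset.sum_congr rfl fun k hk => ?_
        rw [if_pos (by simpa using hk), if_pos (by simpa using hk)]
        module) N
    refine h1.trans ?_
    rw [Finset.sum_range_succ]
    have h2 : ∑ k ∈ Finset.range (m + 1), (‖if k < m + 1 then s (m + 1) k - s m k else s (m + 1) k‖ ^ 2
       + ‖if k < m + 1 then -(c (m + 1) k - c m k) else -(c (m + 1) k)‖ ^ 2) =
       ∑ k ∈ Finset.range (m + 1), (‖s (m + 1) k - s m k‖ ^ 2 + ‖c (m + 1) k - c m k‖ ^ 2) := by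
      refine Finset.sum_congr rfl fun k hk => ?_
      rw [if_pos (by simpa using hk), if_pos (by simpa using hk), norm_neg]
    rw [h2]
    simp only [lt_irrefl, if_false, norm_neg]
    have h3 := ih (m + 1)
    have h4 := (energy_coeff B.hM.le (Uit_energy B (m + 1)) (m + 1)).2.2
    push_cast at h4 ⊢
    have h5 : M ^ 2 / ((m : ℝ) + 1) ^ 4 ≤ 16 * (M ^ 2 / ((m : ℝ) + 1 + 1) ^ 4) := by
      rw [← mul_div_assoc, div_le_div_iff₀ (by positivity) (by positivity)]
      have : ((m : ℝ) + 1 + 1) ^ 4 ≤ (2 * ((m : ℝ) + 1)) ^ 4 := by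
        gcongr; have : (0 : ℝ) ≤ m := by positivity
        linarith
      calc _ ≤ M ^ 2 * (2 * ((m : ℝ) + 1)) ^ 4 := by gcongr
        _ = _ := by ring
    have h6 : 0 ≤ M ^ 2 / ((m : ℝ) + 1 + 1) ^ 4 := by positivity
    change 1 / 128 * (∑ k ∈ Finset.range (m + 1), (‖s (m + 1) k - s m k‖ ^ 2 + ‖c (m + 1) k - c m k‖ ^ 2)
       + (‖s (m + 1) (m + 1)‖ ^ 2 + ‖c (m + 1) (m + 1)‖ ^ 2)) ≤ _
    change ∑ k ∈ Finset.range (m + 1), (‖s (m + 1) k - s m k‖ ^ 2 + ‖c (m + 1) k - c m k‖ ^ 2) ≤ _ at h3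
    change ‖s (m + 1) (m + 1)‖ ^ 2 + ‖c (m + 1) (m + 1)‖ ^ 2 ≤ _ at h4
    linarith

lemma summable_inv_sq : Summable fun k : ℕ => 1 / ((k : ℝ) + 1) ^ 2 := by
  have := (summable_nat_add_iff (f := fun k : ℕ => 1 / (k : ℝ) ^ 2) 1).2
    (Real.summable_one_div_nat_pow.2 (by norm_num))
  simpa using this

lemma Uit_lim (B : BD h Dh D2 K a b e τ ρ C M σ σ1 σ2) : ∃ α β : ℕ → E,
    (∀ k, Filter.Tendsto (fun m => sinC (yC h a b τ σ (Uit h a b e τ σ m)) k) Filter.atTop (nhds (α k)))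
    ∧ (∀ k, Filter.Tendsto (fun m => cosC (yC h a b τ σ (Uit h a b e τ σ m)) k) Filter.atTop (nhds (β k)))
    := by
  have key : ∀ k m, ‖sinC (yC h a b τ σ (Uit h a b e τ σ (m + 1))) k
        - sinC (yC h a b τ σ (Uit h a b e τ σ m)) k‖ ≤ M * (1 / ((m : ℝ) + 1) ^ 2) ∧
      ‖cosC (yC h a b τ σ (Uit h a b e τ σ (m + 1))) k
        - cosC (yC h a b τ σ (Uit h a b e τ σ m)) k‖ ≤ M * (1 / ((m : ℝ) + 1) ^ 2) := by
    intro k m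
    have h1 := Uit_diff B m (k + 1)
    rw [Finset.sum_range_succ] at h1
    have h2 : 0 ≤ ∑ k ∈ Finset.range k, (‖sinC (yC h a b τ σ (Uit h a b e τ σ (m + 1))) k
        - sinC (yC h a b τ σ (Uit h a b e τ σ m)) k‖ ^ 2 +
      ‖cosC (yC h a b τ σ (Uit h a b e τ σ (m + 1))) k
        - cosC (yC h a b τ σ (Uit h a b e τ σ m)) k‖ ^ 2) := Finset.sum_nonneg fun _ _ => by positivity
    have hM := B.hM
    have h3 : M ^ 2 / ((m : ℝ) + 1) ^ 4 = (M * (1 / ((m : ℝ) + 1) ^ 2)) ^ 2 := by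
      field_simp
    rw [h3] at h1
    constructor
    · exact le_of_sq_le_sq (by
        have := sq_nonneg (norm (cosC (yC h a b τ σ (Uit h a b e τ σ (m + 1))) k
          - cosC (yC h a b τ σ (Uit h a b e τ σ m)) k))
        linarith) (by positivity)
    · exact le_of_sq_le_sq (by
        have := sq_nonneg (norm (sinC (yC h a b τ σ (Uit h a b e τ σ (m + 1))) k
          - sinC (yC h a b τ σ (Uit h a b e τ σ m)) k))
        linarith) (by positivity)
  have hsum : Summable fun m : ℕ => M * (1 / ((m : ℝ) + 1) ^ 2) := summable_inv_sq.mul_left M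
  have h1 : ∀ k, ∃ α : E, Filter.Tendsto (fun m => sinC (yC h a b τ σ (Uit h a b e τ σ m)) k)
      Filter.atTop (nhds α) := fun k => by
    apply cauchySeq_tendsto_of_complete
    apply cauchySeq_of_dist_le_of_summable _ _ hsum
    intro m
    rw [dist_comm, dist_eq_norm]; exact (key k m).1
  have h2 : ∀ k, ∃ α : E, Filter.Tendsto (fun m => cosC (yC h a b τ σ (Uit h a b e τ σ m)) k)
      Filter.atTop (nhds α) := fun k => by
    apply cauchySeq_tendsto_of_complete
    apply cauchySeq_of_dist_le_of_summable _ _ hsum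
    intro m
    rw [dist_comm, dist_eq_norm]; exact (key k m).2
  choose α hα using h1
  choose β hβ using h2
  exact ⟨α, β, hα, hβ⟩

end bishop2

section bishop3
variable {E : Type*} [NormedAddCommGroup E] [InnerProductSpace ℝ E]
variable {h : E → E} {Dh : E → E →L[ℝ] E} {D2 : E → E →L[ℝ] E →L[ℝ] E} {K : ℝ}
  {a b e : E} {τ ρ C M : ℝ} {σ σ1 σ2 : ℝ → ℝ}

/-- The limiting real part. -/
noncomputable def UF (e : E) (α β : ℕ → E) (t : ℝ) : E :=
  e + ∑' k : ℕ, (cos (((k : ℝ) + 1) * t) • α k - sin (((k : ℝ) + 1) * t) • β k)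

lemma norm_trig_le (u v : E) (x y : ℝ) : ‖cos x • u + sin y • v‖ ≤ ‖u‖ + ‖v‖ ∧
    ‖cos x • u - sin y • v‖ ≤ ‖u‖ + ‖v‖ := by
  have h1 : ‖cos x • u‖ ≤ ‖u‖ := by
    rw [norm_smul]; exact mul_le_of_le_one_left (norm_nonneg _) (abs_cos_le_one _)
  have h2 : ‖sin y • v‖ ≤ ‖v‖ := by
    rw [norm_smul]; exact mul_le_of_le_one_left (norm_nonneg _) (abs_sin_le_one _)
  exact ⟨(norm_add_le _ _).trans (add_le_add h1 h2), (norm_sub_le _ _).trans (add_le_add h1 h2)⟩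

variable [CompleteSpace E]

theorem bishop (B : BD h Dh D2 K a b e τ ρ C M σ σ1 σ2) : ∃ (α β : ℕ → E) (γ : E),
    (∀ N, ∑ k ∈ Finset.range N, ((k : ℝ) + 1) * (‖α k‖ + ‖β k‖) ≤ 2 * M) ∧
    (‖γ‖ ≤ 18 * K * C ^ 2 * ρ ^ 2) ∧
    (∀ t, ‖UF e α β t‖ ≤ ρ) ∧ (∀ t, ‖UF e α β t - e‖ ≤ 2 * M) ∧
    ∀ t, HasSum (fun k : ℕ => cos (((k : ℝ) + 1) * t) • β k + sin (((k : ℝ) + 1) * t) • α k)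
      (yC h a b τ σ (UF e α β) t - γ) := by
  obtain ⟨α, β, hα, hβ⟩ := Uit_lim B
  set y : ℕ → ℝ → E := fun m => yC h a b τ σ (Uit h a b e τ σ m) with hy
  have hM := B.hM
  have hE : ∀ N, ∑ k ∈ Finset.range N, ((k : ℝ) + 1) ^ 4 * (‖α k‖ ^ 2 + ‖β k‖ ^ 2) ≤ M ^ 2 := by
    intro N
    refine le_of_tendsto' (x := Filter.atTop) (f := fun m => ∑ k ∈ Finset.range N, ((k : ℝ) + 1) ^ 4 *
      (‖sinC (y m) k‖ ^ 2 + ‖cosC (y m) k‖ ^ 2)) ?_ (fun m => Uit_energy B m N)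
    refine tendsto_finsetSum _ fun k _ => ?_
    exact (((hα k).norm.pow 2).add ((hβ k).norm.pow 2)).const_mul _
  have hS := fun N => sum_le_of_energy α β N M hM.le (hE N)
  have hsum1 : Summable fun k : ℕ => ((k : ℝ) + 1) * (‖α k‖ + ‖β k‖) :=
    summable_of_sum_range_le (fun k => by positivity) hS
  have hle : ∀ k : ℕ, ‖α k‖ + ‖β k‖ ≤ ((k : ℝ) + 1) * (‖α k‖ + ‖β k‖) := fun k => by
    have : (0 : ℝ) ≤ k := by positivity
    nlinarith [norm_nonneg (α k), norm_nonneg (β k)]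
  have hsum : Summable fun k : ℕ => ‖α k‖ + ‖β k‖ :=
    Summable.of_nonneg_of_le (fun k => by positivity) hle hsum1
  have hsle : ∑' k, (‖α k‖ + ‖β k‖) ≤ 2 * M :=
    (hsum.tsum_le_tsum hle hsum1).trans (hsum1.tsum_le_of_sum_range_le hS)
  have hUe : ∀ t, ‖UF e α β t - e‖ ≤ 2 * M := by
    intro t
    unfold UF
    rw [add_sub_cancel_left]
    refine (tsum_of_norm_bounded hsum.hasSum fun k => ?_).trans hsle
    exact (norm_trig_le _ _ _ _).2
  have hUρ : ∀ t, ‖UF e α β t‖ ≤ ρ := by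
    intro t
    have h1 := norm_add_le e (UF e α β t - e)
    rw [add_sub_cancel] at h1
    linarith [hUe t, B.he, B.hMρ]
  have hUc : Continuous (UF e α β) := by
    unfold UF
    refine continuous_const.add (continuous_tsum (fun k => by fun_prop) hsum fun k t => ?_)
    exact (norm_trig_le _ _ _ _).2
  have hUp : Function.Periodic (UF e α β) (2 * π) := by
    intro t
    unfold UF
    congr 2
    funext k
    have : ((k : ℝ) + 1) * (t + 2 * π) = ((k : ℝ) + 1) * t + ((k + 1 : ℕ) : ℝ) * (2 * π) := by
      push_cast; ring
    rw [this, cos_add_nat_mul_two_pi, sin_add_nat_mul_two_pi]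
  have hUlim : ∀ t, Filter.Tendsto (fun m => Uit h a b e τ σ (m + 1) t) Filter.atTop
      (nhds (UF e α β t)) := by
    intro t
    have e1 : ∀ m, Uit h a b e τ σ (m + 1) t = e + ∑' k : ℕ, (if k < m + 1 then
        (cos (((k : ℝ) + 1) * t) • sinC (y m) k - sin (((k : ℝ) + 1) * t) • cosC (y m) k) else 0) := by
      intro m
      change e + trigS (sinC (y m)) (fun k => -(cosC (y m) k)) (m + 1) t = _
      congr 1
      rw [tsum_eq_sum (s := Finset.range (m + 1))]
      · unfold trigS
        refine Finset.sum_congr rfl fun k hk => ?_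
        rw [if_pos (by simpa using hk)]; module
      · intro k hk
        rw [if_neg (by simpa using hk)]
    simp_rw [e1]
    unfold UF
    refine Filter.Tendsto.const_add e ?_
    refine tendsto_tsum_of_dominated_convergence (bound := fun k : ℕ => 2 * M * (1 / ((k : ℝ) + 1) ^ 2))
      (summable_inv_sq.mul_left _) (fun k => ?_) (Filter.Eventually.of_forall fun m k => ?_)
    · have h1 := ((hα k).const_smul (cos (((k : ℝ) + 1) * t))).sub
        ((hβ k).const_smul (sin (((k : ℝ) + 1) * t)))
      refine h1.congr' ?_
      filter_upwards [Filter.eventually_ge_atTop k] with m hm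
      rw [if_pos (by omega)]
    · have h2 := energy_coeff hM.le (Uit_energy B m) k
      have h3 : 2 * M * (1 / ((k : ℝ) + 1) ^ 2) = M / ((k : ℝ) + 1) ^ 2 + M / ((k : ℝ) + 1) ^ 2 := by ring
      have h4 : 0 ≤ M / ((k : ℝ) + 1) ^ 2 := by positivity
      split_ifs
      · exact (norm_trig_le _ _ _ _).2.trans (by linarith [h2.1, h2.2.1])
      · rw [norm_zero]; linarith
  have hylim : ∀ t, Filter.Tendsto (fun m => y (m + 1) t) Filter.atTop
      (nhds (yC h a b τ σ (UF e α β) t)) := by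
    intro t
    rw [tendsto_iff_norm_sub_tendsto_zero]
    have h1 := (tendsto_iff_norm_sub_tendsto_zero.1 (hUlim t)).const_mul (6 * K * C ^ 2 * ρ)
    rw [mul_zero] at h1
    refine squeeze_zero (fun _ => norm_nonneg _) (fun m => ?_) h1
    exact yC_lip B.H B.hτ B.hτC (B.hs t) B.hρC (Uit_bound B (m + 1) t) (hUρ t) B.ha B.hb
  have hyc : ∀ m, Continuous (y m) := fun m => B.yC_cont (Uit_cont m) (Uit_bound B m)
  have hyb : ∀ m t, ‖y m t‖ ≤ 18 * K * C ^ 2 * ρ ^ 2 := fun m t =>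
    yC_bound B.H B.hτ B.hτC (B.hs t) B.hρC (Uit_bound B m t) B.ha B.hb
  have hyb' : ∀ t, ‖yC h a b τ σ (UF e α β) t‖ ≤ 18 * K * C ^ 2 * ρ ^ 2 := fun t =>
    yC_bound B.H B.hτ B.hτC (B.hs t) B.hρC (hUρ t) B.ha B.hb
  have hYc := B.yC_cont hUc hUρ
  have hYp : Function.Periodic (yC h a b τ σ (UF e α β)) (2 * π) := yC_periodic B.per hUp
  have eα : ∀ k, sinC (yC h a b τ σ (UF e α β)) k = α k := by
    intro k
    refine tendsto_nhds_unique ?_ ((Filter.tendsto_add_atTop_iff_nat 1).2 (hα k))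
    unfold sinC
    refine Filter.Tendsto.const_smul ?_ _
    refine intervalIntegral.tendsto_integral_filter_of_dominated_convergence
      (fun _ => 18 * K * C ^ 2 * ρ ^ 2) (Filter.Eventually.of_forall fun m => ?_)
      (Filter.Eventually.of_forall fun m => Filter.Eventually.of_forall fun t _ => ?_)
      (by simp) (Filter.Eventually.of_forall fun t _ => ?_)
    · exact Continuous.aestronglyMeasurable
        (Continuous.smul (f := fun t : ℝ => sin (((k : ℝ) + 1) * t)) (by fun_prop) (hyc (m + 1)))
    · rw [norm_smul]
      exact (mul_le_of_le_one_left (norm_nonneg _) (abs_sin_le_one _)).trans (hyb (m + 1) t)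
    · exact (hylim t).const_smul _
  have eβ : ∀ k, cosC (yC h a b τ σ (UF e α β)) k = β k := by
    intro k
    refine tendsto_nhds_unique ?_ ((Filter.tendsto_add_atTop_iff_nat 1).2 (hβ k))
    unfold cosC
    refine Filter.Tendsto.const_smul ?_ _
    refine intervalIntegral.tendsto_integral_filter_of_dominated_convergence
      (fun _ => 18 * K * C ^ 2 * ρ ^ 2) (Filter.Eventually.of_forall fun m => ?_)
      (Filter.Eventually.of_forall fun m => Filter.Eventually.of_forall fun t _ => ?_)
      (by simp) (Filter.Eventually.of_forall fun t _ => ?_)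
    · exact Continuous.aestronglyMeasurable
        (Continuous.smul (f := fun t : ℝ => cos (((k : ℝ) + 1) * t)) (by fun_prop) (hyc (m + 1)))
    · rw [norm_smul]
      exact (mul_le_of_le_one_left (norm_nonneg _) (abs_cos_le_one _)).trans (hyb (m + 1) t)
    · exact (hylim t).const_smul _
  refine ⟨α, β, (2 * π)⁻¹ • ∫ s in (0 : ℝ)..(2 * π), yC h a b τ σ (UF e α β) s, hS, ?_, hUρ, hUe, ?_⟩
  · have h1 := intervalIntegral.norm_integral_le_of_norm_le_const (a := 0) (b := 2 * π)
      (fun t _ => hyb' t)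
    rw [sub_zero, abs_of_pos (by positivity)] at h1
    rw [norm_smul, norm_inv, norm_of_nonneg (by positivity)]
    rw [inv_mul_le_iff₀ (by positivity)]
    linarith
  · intro t
    have h1 := fourier_inversion _ hYc hYp (by simpa only [eα, eβ, add_comm (‖β _‖)] using hsum) t
    simpa only [eα, eβ] using h1

end bishop3

section disc

lemma pow_lip {z w : ℂ} (hz : ‖z‖ ≤ 1) (hw : ‖w‖ ≤ 1) (k : ℕ) :
    ‖z ^ (k + 1) - w ^ (k + 1)‖ ≤ ((k : ℝ) + 1) * ‖z - w‖ := by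
  refine (convex_closedBall (0 : ℂ) 1).norm_image_sub_le_of_norm_hasDerivWithin_le
    (f := fun z : ℂ => z ^ (k + 1)) (f' := fun z => ((k + 1 : ℕ) : ℂ) * z ^ k)
    (fun x _ => (by simpa using (hasDerivAt_pow (k + 1) x).hasDerivWithinAt)) (fun x hx => ?_)
    (by simpa using hw) (by simpa using hz)
  rw [norm_mul, norm_pow, Complex.norm_natCast]
  push_cast
  have : ‖x‖ ^ k ≤ 1 := pow_le_one₀ (norm_nonneg _) (by simpa using hx)
  exact mul_le_of_le_one_right (by positivity) this

variable {F : Type*} [NormedAddCommGroup F] [NormedSpace ℂ F] [CompleteSpace F]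

/-- power series without constant term -/
noncomputable def PS (g : ℕ → F) (z : ℂ) : F := ∑' k : ℕ, z ^ (k + 1) • g k

/-- its derivative -/
noncomputable def PS1 (g : ℕ → F) (z : ℂ) : F := ∑' k : ℕ, (((k : ℂ) + 1) * z ^ k) • g k

variable {g : ℕ → F}

lemma PS_term_le {z : ℂ} (hz : ‖z‖ ≤ 1) (k : ℕ) :
    ‖z ^ (k + 1) • g k‖ ≤ ((k : ℝ) + 1) * ‖g k‖ := by
  rw [norm_smul, norm_pow]
  have : ‖z‖ ^ (k + 1) ≤ 1 := pow_le_one₀ (norm_nonneg _) hz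
  have hk : (0 : ℝ) ≤ k := by positivity
  have := norm_nonneg (g k)
  nlinarith

lemma PS1_term_le {z : ℂ} (hz : ‖z‖ ≤ 1) (k : ℕ) :
    ‖(((k : ℂ) + 1) * z ^ k) • g k‖ ≤ ((k : ℝ) + 1) * ‖g k‖ := by
  have h1 : ‖((k : ℂ) + 1)‖ = (k : ℝ) + 1 := by
    have := Complex.norm_natCast (k + 1); push_cast at this; exact this
  rw [norm_smul, norm_mul, norm_pow, h1]
  have : ‖z‖ ^ k ≤ 1 := pow_le_one₀ (norm_nonneg _) hz
  gcongr
  exact mul_le_of_le_one_right (by positivity) this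

lemma PS_summable (hg : Summable fun k : ℕ => ((k : ℝ) + 1) * ‖g k‖) {z : ℂ} (hz : ‖z‖ ≤ 1) :
    Summable fun k : ℕ => z ^ (k + 1) • g k :=
  Summable.of_norm_bounded hg fun k => PS_term_le hz k

lemma PS_norm_le (hg : Summable fun k : ℕ => ((k : ℝ) + 1) * ‖g k‖) {z : ℂ} (hz : ‖z‖ ≤ 1) :
    ‖PS g z‖ ≤ ∑' k : ℕ, ((k : ℝ) + 1) * ‖g k‖ :=
  tsum_of_norm_bounded hg.hasSum fun k => PS_term_le hz k

lemma PS1_norm_le (hg : Summable fun k : ℕ => ((k : ℝ) + 1) * ‖g k‖) {z : ℂ} (hz : ‖z‖ ≤ 1) :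
    ‖PS1 g z‖ ≤ ∑' k : ℕ, ((k : ℝ) + 1) * ‖g k‖ :=
  tsum_of_norm_bounded hg.hasSum fun k => PS1_term_le hz k

lemma PS1_cont (hg : Summable fun k : ℕ => ((k : ℝ) + 1) * ‖g k‖) :
    ContinuousOn (PS1 g) (closedBall 0 1) := by
  unfold PS1
  refine continuousOn_tsum (fun k => by fun_prop) hg fun k z hz => PS1_term_le (by simpa using hz) k

lemma PS_hasDeriv (hg : Summable fun k : ℕ => ((k : ℝ) + 1) * ‖g k‖) {z : ℂ}
    (hz : z ∈ closedBall (0 : ℂ) 1) :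
    HasDerivWithinAt (PS g) (PS1 g z) (closedBall 0 1) z := by
  have hz' : ‖z‖ ≤ 1 := by simpa using hz
  rw [hasDerivWithinAt_iff_tendsto_slope]
  have h1 : ∀ w ∈ closedBall (0 : ℂ) 1, slope (PS g) z w =
      ∑' k : ℕ, (slope (fun w : ℂ => w ^ (k + 1)) z w) • g k := by
    intro w hw
    have hw' : ‖w‖ ≤ 1 := by simpa using hw
    simp only [slope, vsub_eq_sub]
    unfold PS
    rw [← (PS_summable hg hw').tsum_sub (PS_summable hg hz'), ← tsum_const_smul'']
    congr 1
    funext k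
    rw [smul_eq_mul, mul_smul, sub_smul]
  have h2 : Filter.Tendsto (fun w => ∑' k : ℕ, (slope (fun w : ℂ => w ^ (k + 1)) z w) • g k)
      (nhdsWithin z (closedBall 0 1 \ {z})) (nhds (PS1 g z)) := by
    unfold PS1
    refine tendsto_tsum_of_dominated_convergence hg (fun k => ?_) ?_
    · refine Filter.Tendsto.smul_const ?_ _
      have := (hasDerivAt_pow (k + 1) z).hasDerivWithinAt (s := closedBall 0 1)
      rw [hasDerivWithinAt_iff_tendsto_slope] at this
      simpa using this
    · filter_upwards [self_mem_nhdsWithin] with w hw k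
      have hw' : ‖w‖ ≤ 1 := by simpa using hw.1
      have hwz : w - z ≠ 0 := sub_ne_zero.2 hw.2
      rw [norm_smul]
      gcongr
      simp only [slope, vsub_eq_sub, smul_eq_mul, norm_mul, norm_inv]
      rw [inv_mul_le_iff₀ (norm_pos_iff.2 hwz), mul_comm]
      exact pow_lip hw' hz' k
  refine h2.congr' ?_
  filter_upwards [self_mem_nhdsWithin] with w hw
  exact (h1 w hw.1).symm

lemma disc_regular [NormedSpace ℝ F] [IsScalarTower ℝ ℂ F] {f f' : ℂ → F} {c : ℝ}
    (hd : ∀ z ∈ closedBall (0 : ℂ) 1, HasDerivWithinAt f (f' z) (closedBall 0 1) z)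
    (hc : ContinuousOn f' (closedBall 0 1))
    (h0 : ∀ z ∈ closedBall (0 : ℂ) 1, ‖f z‖ ≤ c) (h1 : ∀ z ∈ closedBall (0 : ℂ) 1, ‖f' z‖ ≤ c) :
    DifferentiableOn ℂ f (ball 0 1) ∧ ContDiffOn ℝ 1 f (closedBall 0 1) ∧
      CkNormOn 1 (closedBall 0 1) f ≤ c := by
  have hu : UniqueDiffOn ℝ (closedBall (0 : ℂ) 1) :=
    uniqueDiffOn_convex (convex_closedBall _ _) (by rw [interior_closedBall _ one_ne_zero]; simp)
  have huc : UniqueDiffOn ℂ (closedBall (0 : ℂ) 1) := hu.mono_field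
  have hdo : DifferentiableOn ℂ f (closedBall 0 1) := fun z hz => (hd z hz).differentiableWithinAt
  have hcd : ContDiffOn ℂ 1 f (closedBall 0 1) := by
    rw [contDiffOn_one_iff_derivWithin huc]
    exact ⟨hdo, hc.congr fun z hz => (hd z hz).derivWithin (huc z hz)⟩
  refine ⟨hdo.mono ball_subset_closedBall, hcd.restrict_scalars ℝ, ?_⟩
  have : Nonempty (closedBall (0 : ℂ) 1) := ⟨⟨0, by simp⟩⟩
  unfold CkNormOn
  refine ciSup_le fun ⟨⟨z, hz⟩, i⟩ => ?_
  fin_cases i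
  · simpa using h0 z hz
  · simp only
    change ‖iteratedFDerivWithin ℝ 1 f (closedBall 0 1) z‖ ≤ c
    rw [norm_iteratedFDerivWithin_one f (hu z hz)]
    have h2 := ((hd z hz).hasFDerivWithinAt.restrictScalars ℝ).fderivWithin (hu z hz)
    rw [h2, ContinuousLinearMap.norm_restrictScalars]
    refine le_trans ?_ (h1 z hz)
    simp

end disc

section hfacts
variable {E : Type*} [NormedAddCommGroup E] [InnerProductSpace ℝ E] [FiniteDimensional ℝ E]

lemma HF_of_C5 {h : E → E} {c₁ : ℝ} (hc₁ : 0 < c₁) (hh : ContDiffOn ℝ 5 h (closedBall (0 : E) 1))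
    (h0 : h 0 = 0) (hD0 : fderivWithin ℝ h (closedBall (0 : E) 1) 0 = 0)
    (hn : CkNormOn 5 (closedBall (0 : E) 1) h ≤ c₁) :
    HF h (fderiv ℝ h) (fderiv ℝ (fderiv ℝ h)) c₁ := by
  have hu : UniqueDiffOn ℝ (closedBall (0 : E) 1) :=
    uniqueDiffOn_convex (convex_closedBall _ _) (by rw [interior_closedBall _ one_ne_zero]; simp)
  have hat : ∀ x ∈ ball (0 : E) 1, ContDiffAt ℝ 5 h x := fun x hx =>
    hh.contDiffAt (Filter.mem_of_superset (isOpen_ball.mem_nhds hx) ball_subset_closedBall)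
  have hb : BddAbove (Set.range fun p : closedBall (0 : E) 1 × Fin (5 + 1) =>
      ‖iteratedFDerivWithin ℝ (p.2 : ℕ) h (closedBall (0 : E) 1) (p.1 : E)‖) := by
    have h1 : ∀ i : Fin (5 + 1), ∃ Bd : ℝ, ∀ x ∈ closedBall (0 : E) 1,
        ‖iteratedFDerivWithin ℝ (i : ℕ) h (closedBall (0 : E) 1) x‖ ≤ Bd := by
      intro i
      have hc := hh.continuousOn_iteratedFDerivWithin (m := (i : ℕ))
        (by exact_mod_cast Nat.lt_succ_iff.1 i.2) hu
      exact (isCompact_closedBall (0 : E) 1).exists_bound_of_continuousOn hc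
    choose Bd hBd using h1
    refine ⟨∑ i, |Bd i|, ?_⟩
    rintro _ ⟨⟨⟨x, hx⟩, i⟩, rfl⟩
    refine (hBd i x hx).trans ((le_abs_self _).trans ?_)
    exact Finset.single_le_sum (f := fun i => |Bd i|) (fun i _ => abs_nonneg _) (Finset.mem_univ i)
  refine ⟨hc₁, fun x hx => ?_, fun x hx => ?_, fun x hx => ?_, fun x hx => ?_, h0, ?_⟩
  · exact ((hat x hx).differentiableAt (by norm_num)).hasFDerivAt
  · exact (((hat x hx).fderiv_right (m := 4) (by norm_num)).differentiableAt (by norm_num)).hasFDerivAt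
  · have h2 := le_ciSup hb (⟨x, ball_subset_closedBall hx⟩, (2 : Fin 6))
    have h3 : ‖iteratedFDerivWithin ℝ 2 h (closedBall (0 : E) 1) x‖ ≤ c₁ := h2.trans hn
    rw [iteratedFDerivWithin_eq_iteratedFDeriv hu ((hat x hx).of_le (by norm_num))
      (ball_subset_closedBall hx)] at h3
    rw [← norm_iteratedFDeriv_fderiv, norm_iteratedFDeriv_one] at h3
    exact h3
  · exact ((((hat x hx).fderiv_right (m := 4) (by norm_num)).fderiv_right (m := 3)
      (by norm_num)).continuousAt).continuousWithinAt
  · rw [← hD0, fderivWithin_of_mem_nhds (closedBall_mem_nhds _ one_pos)]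

end hfacts

section psi

/-- the bump on the circle -/
noncomputable def vB (t : ℝ) : ℝ := Real.smoothTransition (-cos t)

lemma vB_contDiff : ContDiff ℝ 4 vB := by
  unfold vB
  exact Real.smoothTransition.contDiff.comp (Real.contDiff_cos.neg)

lemma vB_cont : Continuous vB := vB_contDiff.continuous

lemma vB_periodic : Function.Periodic vB (2 * π) := fun t => by simp [vB]

lemma vB_nonneg (t : ℝ) : 0 ≤ vB t := Real.smoothTransition.nonneg _

lemma vB_zero {t : ℝ} (ht : 0 ≤ cos t) : vB t = 0 :=
  Real.smoothTransition.zero_of_nonpos (by linarith)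

lemma vB_sin (k : ℕ) : sinC vB k = 0 := by
  unfold sinC
  have h1 := intervalIntegral.integral_comp_sub_left (a := 0) (b := 2 * π)
    (fun t => sin (((k : ℝ) + 1) * t) • vB t) (2 * π)
  have h2 : ∀ t, sin (((k : ℝ) + 1) * (2 * π - t)) • vB (2 * π - t) =
      -(sin (((k : ℝ) + 1) * t) • vB t) := by
    intro t
    have e1 : ((k : ℝ) + 1) * (2 * π - t) = ((k + 1 : ℕ) : ℝ) * (2 * π) - ((k : ℝ) + 1) * t := by
      push_cast; ring
    rw [e1, sin_nat_mul_two_pi_sub]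
    simp [vB]
  simp only [h2, intervalIntegral.integral_neg, sub_self, sub_zero] at h1
  have : ∫ t in (0 : ℝ)..(2 * π), sin (((k : ℝ) + 1) * t) • vB t = 0 := by linarith
  rw [this, smul_zero]

lemma cosC_le {y : ℝ → ℝ} {B : ℝ} (hb : ∀ t, |y t| ≤ B) (k : ℕ) : |cosC y k| ≤ 2 * B := by
  unfold cosC
  have h1 := intervalIntegral.norm_integral_le_of_norm_le_const (a := 0) (b := 2 * π)
      (f := fun t => cos (((k : ℝ) + 1) * t) • y t) (C := B) (fun t _ => by
        rw [norm_smul]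
        exact (mul_le_of_le_one_left (norm_nonneg _) (abs_cos_le_one _)).trans (hb t))
  rw [sub_zero, abs_of_pos (by positivity)] at h1
  rw [← Real.norm_eq_abs, norm_smul, norm_inv, norm_of_nonneg (by positivity)]
  rw [inv_mul_le_iff₀ (by positivity)]
  linarith

lemma vB_decay : ∃ B : ℝ, 0 ≤ B ∧ ∀ k : ℕ, |cosC vB k| ≤ B / ((k : ℝ) + 1) ^ 4 := by
  have hd : ∀ i : ℕ, i < 4 → ∀ t, HasDerivAt (iteratedDeriv i vB) (iteratedDeriv (i + 1) vB t) t := by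
    intro i hi t
    rw [iteratedDeriv_succ]
    exact ((vB_contDiff.differentiable_iteratedDeriv i (by exact_mod_cast hi)) t).hasDerivAt
  have hc : ∀ i : ℕ, i ≤ 4 → Continuous (iteratedDeriv i vB) := fun i hi =>
    vB_contDiff.continuous_iteratedDeriv i (by exact_mod_cast hi)
  have p0 : Function.Periodic (iteratedDeriv 0 vB) (2 * π) := by
    rw [iteratedDeriv_zero]; exact vB_periodic
  have p1 := periodic_deriv (hd 0 (by norm_num)) p0
  have p2 := periodic_deriv (hd 1 (by norm_num)) p1
  have p3 := periodic_deriv (hd 2 (by norm_num)) p2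
  have p4 := periodic_deriv (hd 3 (by norm_num)) p3
  obtain ⟨B, hB⟩ := (isCompact_Icc (a := (0 : ℝ)) (b := 2 * π)).exists_bound_of_continuousOn
    (hc 4 le_rfl).continuousOn
  have hB' : ∀ t, |iteratedDeriv 4 vB t| ≤ B := by
    intro t
    obtain ⟨s, hs, he⟩ := p4.exists_mem_Ico₀ (by positivity) t
    rw [he]
    exact hB s ⟨hs.1, hs.2.le⟩
  refine ⟨2 * B, by linarith [(abs_nonneg _).trans (hB' 0)], fun k => ?_⟩
  have e1 := (sinC_deriv2 _ _ _ (hd 0 (by norm_num)) (hd 1 (by norm_num)) (hc 2 (by norm_num)) p0 p1 k).2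
  have e2 := (sinC_deriv2 _ _ _ (hd 2 (by norm_num)) (hd 3 (by norm_num)) (hc 4 (by norm_num)) p2 p3 k).2
  have e3 := cosC_le hB' k
  rw [iteratedDeriv_zero] at e1
  simp only [Nat.reduceAdd] at e1 e2
  rw [e2, e1] at e3
  rw [le_div_iff₀ (by positivity)]
  refine le_trans (le_of_eq ?_) e3
  simp only [smul_eq_mul, mul_neg, neg_neg, abs_mul]
  rw [abs_of_nonneg (by positivity : 0 ≤ ((k : ℝ) + 1) ^ 2)]
  ring

/-- the mean of the bump -/
noncomputable def vm : ℝ := (2 * π)⁻¹ * ∫ s in (0 : ℝ)..(2 * π), vB s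

lemma vm_pos : 0 < vm := by
  have : 0 < ∫ s in (0 : ℝ)..(2 * π), vB s := by
    refine intervalIntegral.integral_pos (by positivity) vB_cont.continuousOn (fun t _ => vB_nonneg t)
      ⟨π, ⟨by positivity, by linarith [pi_pos]⟩, ?_⟩
    unfold vB
    exact Real.smoothTransition.pos_of_pos (by simp)
  unfold vm
  positivity

lemma poisson_ge {w : ℂ} {r : ℝ} (hr : 0 ≤ r) (hr1 : r < 1) (hw : ‖w‖ = r) :
    (1 - r) / 4 ≤ 1 + 2 * (w / (1 - w)).re := by
  have hne : 1 - w ≠ 0 := by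
    intro h0
    have : w = 1 := by linear_combination -h0
    rw [this] at hw; simp at hw; linarith
  have hN : 0 < Complex.normSq (1 - w) := Complex.normSq_pos.2 hne
  have hN4 : Complex.normSq (1 - w) ≤ 4 := by
    rw [Complex.normSq_eq_norm_sq]
    have := norm_sub_le 1 w
    rw [norm_one, hw] at this
    nlinarith [norm_nonneg (1 - w)]
  have hN' : Complex.normSq (1 - w) = (1 - w.re) ^ 2 + w.im ^ 2 := by
    rw [Complex.normSq_apply]; simp; ring
  have hw2 : r ^ 2 = w.re ^ 2 + w.im ^ 2 := by
    rw [← hw, ← Complex.normSq_eq_norm_sq, Complex.normSq_apply]; ring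
  have h1 : 1 + 2 * (w / (1 - w)).re = (1 - r ^ 2) / Complex.normSq (1 - w) := by
    rw [Complex.div_re, hw2]
    simp only [Complex.sub_re, Complex.one_re, Complex.sub_im, Complex.one_im]
    rw [hN'] at hN ⊢
    have hN0 := hN.ne'
    field_simp
    ring
  rw [h1, div_le_div_iff₀ (by norm_num) hN]
  nlinarith

lemma exp_pow_eq (t : ℝ) (k : ℕ) : Complex.exp (t * Complex.I) ^ (k + 1) =
    (cos (((k : ℝ) + 1) * t) : ℂ) + (sin (((k : ℝ) + 1) * t) : ℂ) * Complex.I := by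
  rw [← Complex.exp_nat_mul]
  have : ((k + 1 : ℕ) : ℂ) * (t * Complex.I) = (((((k : ℝ) + 1) * t : ℝ)) : ℂ) * Complex.I := by
    push_cast; ring
  rw [this, Complex.exp_mul_I, Complex.ofReal_cos, Complex.ofReal_sin]

lemma poisson_lower {r : ℝ} (hr : 0 ≤ r) (hr1 : r < 1) :
    vm * ((1 - r) / 4) ≤ vm + ∑' k : ℕ, cosC vB k * r ^ (k + 1) := by
  have hv := vB_cont
  have hwn : ∀ t : ℝ, ‖(r : ℂ) * Complex.exp (t * Complex.I)‖ = r := fun t => by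
    simp [Complex.norm_exp_ofReal_mul_I, abs_of_nonneg hr]
  set P : ℝ → ℝ := fun t => (((r : ℂ) * Complex.exp (t * Complex.I)) /
    (1 - (r : ℂ) * Complex.exp (t * Complex.I))).re with hP
  have hPc : Continuous P := by
    refine Complex.continuous_re.comp (Continuous.div (by fun_prop) (by fun_prop) fun t h0 => ?_)
    have := hwn t
    rw [← sub_eq_zero.1 h0] at this
    simp at this; linarith
  have hS : ∀ t : ℝ, HasSum (fun k : ℕ => r ^ (k + 1) * cos (((k : ℝ) + 1) * t)) (P t) := by
    intro t
    have h1 := ((hasSum_geometric_of_norm_lt_one (ξ := (r : ℂ) * Complex.exp (t * Complex.I))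
      (by rw [hwn]; exact hr1)).mul_left ((r : ℂ) * Complex.exp (t * Complex.I)))
    have h2 := Complex.hasSum_re h1
    rw [← div_eq_mul_inv] at h2
    have e1 : (fun k : ℕ => r ^ (k + 1) * cos (((k : ℝ) + 1) * t)) = fun k : ℕ =>
        ((r : ℂ) * Complex.exp (t * Complex.I) * ((r : ℂ) * Complex.exp (t * Complex.I)) ^ k).re := by
      funext k
      rw [← pow_succ', mul_pow, exp_pow_eq, ← Complex.ofReal_pow, Complex.re_ofReal_mul]
      congr 1
      simp only [Complex.add_re, Complex.ofReal_re, Complex.re_ofReal_mul, Complex.I_re, mul_zero, add_zero]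
    rw [e1]
    exact h2
  have hgeo : Summable fun k : ℕ => r ^ (k + 1) :=
    (summable_nat_add_iff 1).2 (summable_geometric_of_lt_one hr hr1)
  have h1 : HasSum (fun k : ℕ => ∫ t in (0 : ℝ)..(2 * π), r ^ (k + 1) * cos (((k : ℝ) + 1) * t) * vB t)
      (∫ t in (0 : ℝ)..(2 * π), P t * vB t) := by
    refine intervalIntegral.hasSum_integral_of_dominated_convergence
      (fun k _ => r ^ (k + 1)) (fun k => ?_)
      (fun k => Filter.Eventually.of_forall fun t _ => ?_)
      (Filter.Eventually.of_forall fun t _ => hgeo) (by simp)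
      (Filter.Eventually.of_forall fun t _ => (hS t).mul_right _)
    · exact Continuous.aestronglyMeasurable (by fun_prop)
    · rw [norm_mul, norm_mul, norm_pow, norm_of_nonneg hr, mul_assoc]
      refine mul_le_of_le_one_right (by positivity) ?_
      refine mul_le_one₀ (abs_cos_le_one _) (norm_nonneg _) ?_
      rw [norm_of_nonneg (vB_nonneg t)]
      exact Real.smoothTransition.le_one _
  have h2 : ∀ k : ℕ, ∫ t in (0 : ℝ)..(2 * π), r ^ (k + 1) * cos (((k : ℝ) + 1) * t) * vB t =
      π * (cosC vB k * r ^ (k + 1)) := by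
    intro k
    unfold cosC
    simp only [mul_assoc, intervalIntegral.integral_const_mul, smul_eq_mul]
    have := pi_pos.ne'
    field_simp
  simp only [h2] at h1
  have h3 := h1.tsum_eq
  rw [tsum_mul_left] at h3
  have h4 : ∫ t in (0 : ℝ)..(2 * π), (1 - r) / 4 * vB t ≤
      ∫ t in (0 : ℝ)..(2 * π), (vB t + 2 * (P t * vB t)) := by
    apply intervalIntegral.integral_mono_on (by positivity)
      (Continuous.intervalIntegrable (by fun_prop) _ _)
      (Continuous.intervalIntegrable (by fun_prop) _ _)
    intro t _
    have := mul_le_mul_of_nonneg_right (poisson_ge hr hr1 (hwn t)) (vB_nonneg t)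
    simp only [hP]
    linarith
  rw [intervalIntegral.integral_const_mul, intervalIntegral.integral_add
    (Continuous.intervalIntegrable (by fun_prop) _ _) (Continuous.intervalIntegrable (by fun_prop) _ _),
    intervalIntegral.integral_const_mul, ← h3] at h4
  have h5 : ∫ t in (0 : ℝ)..(2 * π), vB t = 2 * π * vm := by
    unfold vm; have := pi_pos.ne'; field_simp
  rw [h5] at h4
  refine le_of_mul_le_mul_left (a := 2 * π) ?_ (by positivity)
  linarith

end psi

section psi2

/-- the boundary real part of the model function and its derivatives -/
noncomputable def sg0 (t : ℝ) : ℝ := ∑' k : ℕ, -(cosC vB k * sin (((k : ℝ) + 1) * t))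
/-- first derivative -/
noncomputable def sg1 (t : ℝ) : ℝ := ∑' k : ℕ, -(cosC vB k * (cos (((k : ℝ) + 1) * t) * ((k : ℝ) + 1)))
/-- second derivative -/
noncomputable def sg2 (t : ℝ) : ℝ :=
  ∑' k : ℕ, (cosC vB k * (sin (((k : ℝ) + 1) * t) * ((k : ℝ) + 1) ^ 2))

/-- coefficients of the model function -/
noncomputable def gP (k : ℕ) : ℂ := Complex.I * ((cosC vB k : ℝ) : ℂ)

/-- the model function -/
noncomputable def psi (z : ℂ) : ℂ := PS gP z - PS gP 1

lemma gP_norm (k : ℕ) : ‖gP k‖ = |cosC vB k| := by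
  unfold gP; rw [norm_mul, Complex.norm_I, Complex.norm_real, one_mul]; rfl

lemma sum2 : Summable fun k : ℕ => ((k : ℝ) + 1) ^ 2 * |cosC vB k| := by
  obtain ⟨B, hB, h1⟩ := vB_decay
  refine Summable.of_nonneg_of_le (fun k => by positivity) (fun k => ?_) (summable_inv_sq.mul_left B)
  calc ((k : ℝ) + 1) ^ 2 * |cosC vB k| ≤ ((k : ℝ) + 1) ^ 2 * (B / ((k : ℝ) + 1) ^ 4) := by
        gcongr; exact h1 k
    _ = _ := by field_simp

lemma sum1 : Summable fun k : ℕ => ((k : ℝ) + 1) * |cosC vB k| := by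
  refine Summable.of_nonneg_of_le (fun k => by positivity) (fun k => ?_) sum2
  have : (0 : ℝ) ≤ k := by positivity
  gcongr
  nlinarith

lemma sum0 : Summable fun k : ℕ => |cosC vB k| := by
  refine Summable.of_nonneg_of_le (fun k => by positivity) (fun k => ?_) sum1
  have : (0 : ℝ) ≤ k := by positivity
  nlinarith [abs_nonneg (cosC vB k)]

lemma gsum : Summable fun k : ℕ => ((k : ℝ) + 1) * ‖gP k‖ := by
  simpa only [gP_norm] using sum1

lemma t0 (k : ℕ) (t : ℝ) : ‖-(cosC vB k * sin (((k : ℝ) + 1) * t))‖ ≤ |cosC vB k| := by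
  rw [norm_neg, norm_mul]
  exact mul_le_of_le_one_right (abs_nonneg _) (abs_sin_le_one _)

lemma t1 (k : ℕ) (t : ℝ) : ‖-(cosC vB k * (cos (((k : ℝ) + 1) * t) * ((k : ℝ) + 1)))‖ ≤
    ((k : ℝ) + 1) * |cosC vB k| := by
  rw [norm_neg, norm_mul, norm_mul, norm_of_nonneg (by positivity : 0 ≤ (k : ℝ) + 1), mul_comm,
    Real.norm_eq_abs, Real.norm_eq_abs]
  gcongr
  exact mul_le_of_le_one_left (by positivity) (abs_cos_le_one _)

lemma t2 (k : ℕ) (t : ℝ) : ‖(cosC vB k * (sin (((k : ℝ) + 1) * t) * ((k : ℝ) + 1) ^ 2))‖ ≤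
    ((k : ℝ) + 1) ^ 2 * |cosC vB k| := by
  rw [norm_mul, norm_mul, norm_of_nonneg (by positivity : 0 ≤ ((k : ℝ) + 1) ^ 2), mul_comm,
    Real.norm_eq_abs, Real.norm_eq_abs]
  gcongr
  exact mul_le_of_le_one_left (by positivity) (abs_sin_le_one _)

/-- uniform constant -/
noncomputable def Cp : ℝ := 2 * (∑' k : ℕ, ((k : ℝ) + 1) ^ 2 * |cosC vB k|) + 1

lemma sums_le : ∑' k : ℕ, |cosC vB k| ≤ ∑' k : ℕ, ((k : ℝ) + 1) * |cosC vB k| ∧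
    ∑' k : ℕ, ((k : ℝ) + 1) * |cosC vB k| ≤ ∑' k : ℕ, ((k : ℝ) + 1) ^ 2 * |cosC vB k| ∧
    0 ≤ ∑' k : ℕ, ((k : ℝ) + 1) ^ 2 * |cosC vB k| := by
  refine ⟨sum0.tsum_le_tsum (fun k => ?_) sum1, sum1.tsum_le_tsum (fun k => ?_) sum2,
    tsum_nonneg fun k => by positivity⟩
  · have : (0 : ℝ) ≤ k := by positivity
    nlinarith [abs_nonneg (cosC vB k)]
  · have : (0 : ℝ) ≤ k := by positivity
    gcongr
    nlinarith

lemma Cp_pos : 1 ≤ Cp := by unfold Cp; linarith [sums_le.2.2]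

lemma sg0_le (t : ℝ) : |sg0 t| ≤ Cp := by
  have := tsum_of_norm_bounded sum0.hasSum (fun k => t0 k t)
  have h2 := sums_le
  unfold Cp sg0; rw [← Real.norm_eq_abs]; linarith

lemma sg1_le (t : ℝ) : |sg1 t| ≤ Cp := by
  have := tsum_of_norm_bounded sum1.hasSum (fun k => t1 k t)
  have h2 := sums_le
  unfold Cp sg1; rw [← Real.norm_eq_abs]; linarith

lemma sg2_le (t : ℝ) : |sg2 t| ≤ Cp := by
  have := tsum_of_norm_bounded sum2.hasSum (fun k => t2 k t)
  have h2 := sums_le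
  unfold Cp sg2; rw [← Real.norm_eq_abs]; linarith

lemma sg2_cont : Continuous sg2 := by
  unfold sg2
  exact continuous_tsum (fun k => by fun_prop) sum2 t2

lemma lin_deriv (k : ℕ) (t : ℝ) : HasDerivAt (fun t : ℝ => ((k : ℝ) + 1) * t) ((k : ℝ) + 1) t := by
  simpa using (hasDerivAt_id t).const_mul ((k : ℝ) + 1)

lemma sg0_deriv (t : ℝ) : HasDerivAt sg0 (sg1 t) t := by
  unfold sg0 sg1
  refine hasDerivAt_tsum sum1 (fun k t => ?_) t1 (y₀ := 0) ?_ t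
  · exact ((lin_deriv k t).sin.const_mul _).neg
  · simp

lemma sg1_deriv (t : ℝ) : HasDerivAt sg1 (sg2 t) t := by
  unfold sg1 sg2
  refine hasDerivAt_tsum sum2 (fun k t => ?_) t2 (y₀ := 0) ?_ t
  · refine (((lin_deriv k t).cos.mul_const _).const_mul _).neg.congr_deriv ?_
    ring
  · exact Summable.of_norm_bounded sum1 (fun k => t1 k 0)

lemma sg0_periodic : Function.Periodic sg0 (2 * π) := by
  intro t
  unfold sg0
  congr 1
  funext k
  have : ((k : ℝ) + 1) * (t + 2 * π) = ((k : ℝ) + 1) * t + ((k + 1 : ℕ) : ℝ) * (2 * π) := by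
    push_cast; ring
  rw [this, sin_add_nat_mul_two_pi]

lemma vB_sum (t : ℝ) : HasSum (fun k : ℕ => cosC vB k * cos (((k : ℝ) + 1) * t)) (vB t - vm) := by
  have h1 := fourier_inversion vB vB_cont vB_periodic
    (by simpa only [vB_sin, norm_zero, add_zero, Real.norm_eq_abs] using sum0) t
  simp only [vB_sin, add_zero, smul_eq_mul, mul_zero] at h1
  simp only [mul_comm (cosC vB _)]
  exact h1

lemma PS_circle (t : ℝ) : PS gP (Complex.exp (t * Complex.I)) =
    (sg0 t : ℂ) + ((vB t - vm : ℝ) : ℂ) * Complex.I := by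
  have h1 : HasSum (fun k : ℕ => -(cosC vB k * sin (((k : ℝ) + 1) * t))) (sg0 t) :=
    (Summable.of_norm_bounded sum0 (fun k => t0 k t)).hasSum
  have h2 := (Complex.hasSum_ofReal.2 h1).add ((Complex.hasSum_ofReal.2 (vB_sum t)).mul_right Complex.I)
  rw [← h2.tsum_eq]
  unfold PS
  congr 1
  funext k
  rw [exp_pow_eq, gP, smul_eq_mul]
  simp only [Complex.ofReal_neg, Complex.ofReal_mul]
  linear_combination ((sin (((k : ℝ) + 1) * t) : ℝ) : ℂ) * ((cosC vB k : ℝ) : ℂ) * Complex.I_mul_I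

lemma PS_one : PS gP 1 = ((-vm : ℝ) : ℂ) * Complex.I := by
  have h1 := PS_circle 0
  have h2 : sg0 0 = 0 := by simp [sg0]
  have h3 : vB 0 = 0 := vB_zero (by simp)
  rw [h2, h3] at h1
  simpa using h1

lemma psi_circle (t : ℝ) : psi (Complex.exp (t * Complex.I)) = (sg0 t : ℂ) + (vB t : ℂ) * Complex.I := by
  unfold psi
  rw [PS_circle, PS_one]
  push_cast
  ring

lemma psi_arc {t : ℝ} (ht : |t| ≤ 1) : psi (Complex.exp (t * Complex.I)) = (sg0 t : ℂ) := by
  rw [psi_circle, vB_zero]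
  · simp
  · apply cos_nonneg_of_mem_Icc
    have := abs_le.1 ht
    have := pi_gt_three
    constructor <;> linarith

lemma psi_le {z : ℂ} (hz : ‖z‖ ≤ 1) : ‖psi z‖ ≤ Cp ∧ ‖PS1 gP z‖ ≤ Cp := by
  have h1 := PS_norm_le gsum hz
  have h2 := PS_norm_le gsum (z := 1) (by simp)
  have h3 := PS1_norm_le gsum hz
  simp only [gP_norm] at h1 h2 h3
  have h4 := sums_le
  have := norm_sub_le (PS gP z) (PS gP 1)
  unfold psi Cp
  constructor <;> linarith

lemma psi_real {s : ℝ} (hs : 0 < s) (hs1 : s < 1) : ∃ τ : ℝ, psi (1 - s) = (τ : ℂ) * Complex.I ∧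
    vm / 4 * s ≤ τ ∧ τ ≤ Cp * s := by
  have hr : ‖((1 - s : ℝ) : ℂ)‖ ≤ 1 := by
    rw [Complex.norm_real, norm_of_nonneg (by linarith)]; linarith
  have e1 : PS gP (1 - s) = ((∑' k : ℕ, cosC vB k * (1 - s) ^ (k + 1) : ℝ) : ℂ) * Complex.I := by
    unfold PS
    rw [Complex.ofReal_tsum, ← tsum_mul_right]
    congr 1
    funext k
    rw [gP, smul_eq_mul]; push_cast; ring
  have e2 : psi (1 - s) = ((vm + ∑' k : ℕ, cosC vB k * (1 - s) ^ (k + 1) : ℝ) : ℂ) * Complex.I := by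
    unfold psi
    rw [e1, PS_one]; push_cast; ring
  refine ⟨_, e2, ?_, ?_⟩
  · have := poisson_lower (r := 1 - s) (by linarith) (by linarith)
    linarith
  · have h1 : ‖psi (1 - s)‖ ≤ ∑' k : ℕ, ((k : ℝ) + 1) * |cosC vB k| * s := by
      unfold psi PS
      have hr' : ‖(1 - s : ℂ)‖ ≤ 1 := by simpa using hr
      rw [← (PS_summable gsum hr').tsum_sub (PS_summable gsum (z := 1) (by simp))]
      refine tsum_of_norm_bounded (sum1.mul_right s).hasSum fun k => ?_
      rw [← sub_smul, norm_smul, gP_norm]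
      have := pow_lip hr' (w := 1) (by simp) k
      have e3 : ‖(1 : ℂ) - s - 1‖ = s := by
        rw [show (1 : ℂ) - s - 1 = -(s : ℂ) by ring, norm_neg, Complex.norm_real, norm_of_nonneg hs.le]
      rw [e3] at this
      calc _ ≤ ((k : ℝ) + 1) * s * |cosC vB k| := by gcongr
        _ = _ := by ring
    rw [tsum_mul_right] at h1
    rw [e2, norm_mul, Complex.norm_I, mul_one, Complex.norm_real] at h1
    have h2 := sums_le
    refine (le_abs_self _).trans (h1.trans ?_)
    unfold Cp
    gcongr
    linarith

lemma psi_one : psi 1 = 0 := by simp [psi]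

lemma psi_deriv {z : ℂ} (hz : z ∈ closedBall (0 : ℂ) 1) :
    HasDerivWithinAt psi (PS1 gP z) (closedBall 0 1) z := by
  unfold psi
  exact (PS_hasDeriv gsum hz).sub_const _

end psi2

section final
variable {n : ℕ}

/-- complexification of real vectors -/
noncomputable def cplx (n : ℕ) : EuclideanSpace ℝ (Fin n) →ₗᵢ[ℝ] EuclideanSpace ℂ (Fin n) where
  toFun x := WithLp.toLp 2 fun j => (x j : ℂ)
  map_add' x y := by ext j; simp
  map_smul' c x := by ext j; simp
  norm_map' x := by simp [EuclideanSpace.norm_eq]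

@[simp] lemma cplx_apply (x : EuclideanSpace ℝ (Fin n)) (j : Fin n) : cplx n x j = (x j : ℂ) := rfl

/-- coefficients of the correction -/
noncomputable def gC (α β : ℕ → EuclideanSpace ℝ (Fin n)) (k : ℕ) : EuclideanSpace ℂ (Fin n) :=
  cplx n (α k) + Complex.I • cplx n (β k)

lemma gC_norm (α β : ℕ → EuclideanSpace ℝ (Fin n)) (k : ℕ) : ‖gC α β k‖ ≤ ‖α k‖ + ‖β k‖ := by
  unfold gC
  refine (norm_add_le _ _).trans ?_
  rw [norm_smul, Complex.norm_I, one_mul, LinearIsometry.norm_map, LinearIsometry.norm_map]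

lemma disc_alg {V : Type*} [AddCommGroup V] [Module ℂ V] (s q : ℂ) (a b u y : V) :
    a + s • b + q • (u + Complex.I • y) = (a + s • b + q • u) + Complex.I • (q • y) := by
  module

lemma UF_hasSum (α β : ℕ → EuclideanSpace ℝ (Fin n)) {M : ℝ}
    (hS : ∀ N, ∑ k ∈ Finset.range N, ((k : ℝ) + 1) * (‖α k‖ + ‖β k‖) ≤ 2 * M) (e : EuclideanSpace ℝ (Fin n)) (t : ℝ) :
    HasSum (fun k : ℕ => cos (((k : ℝ) + 1) * t) • α k - sin (((k : ℝ) + 1) * t) • β k)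
        (UF e α β t - e) := by
  have hsumAB : Summable fun k : ℕ => ‖α k‖ + ‖β k‖ := by
    refine summable_of_sum_range_le (c := 2 * M) (fun k => by positivity) fun N => le_trans ?_ (hS N)
    refine Finset.sum_le_sum fun k _ => ?_
    have : (0 : ℝ) ≤ k := by positivity
    nlinarith [norm_nonneg (α k), norm_nonneg (β k)]
  unfold UF
  rw [add_sub_cancel_left]
  exact (Summable.of_norm_bounded (f := fun k : ℕ => cos (((k : ℝ) + 1) * t) • α k
        - sin (((k : ℝ) + 1) * t) • β k) hsumAB fun k => (norm_trig_le _ _ _ _).2).hasSum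

lemma PS_circ (α β : ℕ → EuclideanSpace ℝ (Fin n)) {t : ℝ} {u w : EuclideanSpace ℝ (Fin n)}
    (h1 : HasSum (fun k : ℕ => cos (((k : ℝ) + 1) * t) • α k - sin (((k : ℝ) + 1) * t) • β k) u)
    (hy : HasSum (fun k : ℕ => cos (((k : ℝ) + 1) * t) • β k + sin (((k : ℝ) + 1) * t) • α k) w) :
    PS (gC α β) (Complex.exp (t * Complex.I)) = cplx n u + Complex.I • cplx n w := by
  have h2 := h1.mapL (cplx n).toContinuousLinearMap
  have h3 := (hy.mapL (cplx n).toContinuousLinearMap).const_smul Complex.I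
  have h4 := h2.add h3
  refine Eq.trans ?_ h4.tsum_eq
  unfold PS
  congr 1
  funext k
  rw [exp_pow_eq]
  ext j
  simp only [gC, LinearIsometry.coe_toContinuousLinearMap, PiLp.smul_apply, PiLp.add_apply, cplx_apply,
        PiLp.sub_apply, smul_eq_mul, Complex.ofReal_add, Complex.ofReal_sub, Complex.ofReal_mul]
  linear_combination ((sin (((k : ℝ) + 1) * t) : ℝ) : ℂ) * ((β k j : ℝ) : ℂ) * Complex.I_mul_I

set_option maxHeartbeats 4000000 in
theorem disc_main (hn : 1 ≤ n) {h : EuclideanSpace ℝ (Fin n) → EuclideanSpace ℝ (Fin n)} {Dh D2} {K : ℝ}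
    (H : HF h Dh D2 K) {ρ δ : ℝ} (hρ : 0 < ρ) (hρC : 12 * ρ * Cp ^ 2 ≤ 1)
    (hρA : 23 * n * (232 * K * Cp ^ 2) * ρ ≤ 1) (hδ : δ = ρ / (2 * n))
    (p : EuclideanSpace ℂ (Fin n)) {s τ : ℝ} (hs : 0 < s) (hs1 : s < 1)
    (hτ : psi (1 - s) = (τ : ℂ) * Complex.I) (hτ0 : 0 < τ) (hτC : τ ≤ Cp * s) (hpτ : ‖p‖ ≤ δ / 4 * τ ^ 2) :
    ∃ f : ℂ → EuclideanSpace ℂ (Fin n),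
      DifferentiableOn ℂ f (ball (0 : ℂ) 1) ∧
      ContDiffOn ℝ 1 f (closedBall (0 : ℂ) 1) ∧
      CkNormOn 1 (closedBall (0 : ℂ) 1) f ≤ 13 * Cp ^ 2 ∧
      (∀ θ : ℝ, |θ| ≤ 1 →
              ∃ x : EuclideanSpace ℝ (Fin n), ‖x‖ ≤ 1 ∧ (∀ j : Fin n, 0 ≤ x j) ∧
                ∀ j : Fin n, f (Complex.exp (θ * Complex.I)) j =
                  (x j : ℂ) + (h x j : ℂ) * Complex.I) ∧
      ‖f 1‖ ≤ ‖p‖ + 3 * Cp ^ 2 * s ^ 2 ∧ f (1 - s) = p := by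
  have hC := Cp_pos
  have hK := H.hK
  have hn1 : (1 : ℝ) ≤ n := by exact_mod_cast hn
  have hn0 : (0 : ℝ) < n := by linarith
  have hδ0 : 0 < δ := by rw [hδ]; positivity
  have hδn : n * δ = ρ / 2 := by rw [hδ]; field_simp
  have hδρ : δ ≤ ρ / 2 := by nlinarith
  have hC2 : 1 ≤ Cp ^ 2 := by nlinarith
  have hρ1 : ρ ≤ 1 / 12 := by nlinarith
  have hτC' : τ ≤ Cp := by nlinarith
  set A := 232 * K * Cp ^ 2 with hA
  have hA0 : 0 < A := by positivity
  have hAρ : 23 * A * ρ ≤ 1 := by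
    have : 0 < A * ρ := by positivity
    nlinarith
  -- the data
  set a : EuclideanSpace ℝ (Fin n) := WithLp.toLp 2 fun j => (p j).re with ha
  set b : EuclideanSpace ℝ (Fin n) := WithLp.toLp 2 fun j => (p j).im / τ with hb
  set e : EuclideanSpace ℝ (Fin n) := WithLp.toLp 2 fun _ => δ with he
  have hpj : ∀ j, |(p j).re| ≤ δ / 4 * τ ^ 2 ∧ |(p j).im| ≤ δ / 4 * τ ^ 2 := fun j =>
    have h1 := PiLp.norm_apply_le p j
    ⟨(Complex.abs_re_le_norm _).trans (h1.trans hpτ), (Complex.abs_im_le_norm _).trans (h1.trans hpτ)⟩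
  have han : ‖a‖ ≤ ‖p‖ := by
    rw [EuclideanSpace.norm_eq, EuclideanSpace.norm_eq]
    gcongr with j
    exact Complex.abs_re_le_norm (p j)
  have hbn : ‖b‖ ≤ ‖p‖ / τ := by
    rw [le_div_iff₀ hτ0]
    have e1 : ‖b‖ * τ = ‖τ • b‖ := by rw [norm_smul, norm_of_nonneg hτ0.le, mul_comm]
    rw [e1, EuclideanSpace.norm_eq, EuclideanSpace.norm_eq]
    gcongr with j
    have : (τ • b) j = (p j).im := by
      simp only [PiLp.smul_apply, hb, smul_eq_mul]; field_simp
    rw [this]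
    exact Complex.abs_im_le_norm (p j)
  have ha' : ‖a‖ ≤ ρ * τ ^ 2 := han.trans (hpτ.trans (by gcongr; linarith))
  have hb' : ‖b‖ ≤ ρ * τ := hbn.trans (by
    rw [div_le_iff₀ hτ0]
    refine hpτ.trans ?_
    have : 0 < τ ^ 2 := by positivity
    nlinarith)
  have he' : ‖e‖ ≤ ρ / 2 := by
    rw [← hδn, EuclideanSpace.norm_eq]
    apply Real.sqrt_le_iff.2 ⟨by positivity, ?_⟩
    simp only [he, norm_of_nonneg hδ0.le, Finset.sum_const, Finset.card_univ, Fintype.card_fin, nsmul_eq_mul]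
    rw [mul_pow]
    gcongr
    nlinarith
  set M := δ / 4 with hM
  have B : BD h Dh D2 K a b e τ ρ Cp M sg0 sg1 sg2 :=
    { H := H, hτ := hτ0, hτC := hτC', hs := sg0_le, hs1 := sg1_le, hs2 := sg2_le, hσ := sg0_deriv
      hσ1 := sg1_deriv, hσ2 := sg2_cont, per := sg0_periodic, hρC := by linarith, ha := ha', hb := hb'
      he := he', hM := by positivity, hMρ := by linarith
      hA := by
        rw [← hA, hM, hδ]
        have h1 : (23 * n * A * ρ) ^ 2 ≤ 1 := pow_le_one₀ (by positivity) hρA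
        rw [div_div, div_pow, le_div_iff₀ (by positivity)]
        have : 0 < ρ ^ 2 := by positivity
        have h2 := mul_le_mul_of_nonneg_right h1 this.le
        have h3 : 0 ≤ (n * A * ρ) ^ 2 * ρ ^ 2 := by positivity
        nlinarith }
  obtain ⟨α, β, γ, hS, hγ, hUρ, hUe, hy⟩ := bishop B
  have hMρ := B.hMρ
  have hM0 := B.hM
  have hγ' : ‖γ‖ ≤ ρ := hγ.trans (by
    have : 18 * K * Cp ^ 2 ≤ A := by rw [hA]; gcongr; norm_num
    have h2 : 18 * K * Cp ^ 2 * ρ ^ 2 ≤ A * ρ ^ 2 := by gcongr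
    nlinarith)
  have hgS : ∀ N, ∑ k ∈ Finset.range N, ((k : ℝ) + 1) * ‖gC α β k‖ ≤ 2 * M := fun N =>
    (Finset.sum_le_sum fun k _ => mul_le_mul_of_nonneg_left (gC_norm α β k) (by positivity)).trans (hS N)
  have hg : Summable fun k : ℕ => ((k : ℝ) + 1) * ‖gC α β k‖ :=
    summable_of_sum_range_le (fun k => by positivity) hgS
  have hgt : ∑' k : ℕ, ((k : ℝ) + 1) * ‖gC α β k‖ ≤ 2 * M := hg.tsum_le_of_sum_range_le hgS
  -- the functions
  set G : ℂ → EuclideanSpace ℂ (Fin n) := fun z => (cplx n e + Complex.I • cplx n γ) + PS (gC α β) z with hG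
  have hGn : ∀ z ∈ closedBall (0 : ℂ) 1, ‖G z‖ ≤ 3 ∧ ‖PS1 (gC α β) z‖ ≤ 3 := by
    intro z hz
    have hz' : ‖z‖ ≤ 1 := by simpa using hz
    have h1 := (PS_norm_le hg hz').trans hgt
    have h2 := (PS1_norm_le hg hz').trans hgt
    have h3 : ‖G z‖ ≤ ‖cplx n e‖ + ‖Complex.I • cplx n γ‖ + ‖PS (gC α β) z‖ := norm_add₃_le
    rw [norm_smul, Complex.norm_I, one_mul, LinearIsometry.norm_map, LinearIsometry.norm_map] at h3
    constructor <;> linarith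
  have hGd : ∀ z ∈ closedBall (0 : ℂ) 1, HasDerivWithinAt G (PS1 (gC α β) z) (closedBall 0 1) z :=
    fun z hz => (PS_hasDeriv hg hz).const_add _
  have hGcirc : ∀ t : ℝ, G (Complex.exp (t * Complex.I)) =
      cplx n (UF e α β t) + Complex.I • cplx n (yC h a b τ sg0 (UF e α β) t) := by
    intro t
    simp only [hG]
    rw [PS_circ α β (UF_hasSum α β hS e t) (hy t), map_sub, map_sub]
    module
  set f : ℂ → EuclideanSpace ℂ (Fin n) := fun z =>
    cplx n a + psi z • cplx n b + (psi z ^ 2 + (τ : ℂ) ^ 2) • G z with hf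
  set f' : ℂ → EuclideanSpace ℂ (Fin n) := fun z =>
    PS1 gP z • cplx n b + ((psi z ^ 2 + (τ : ℂ) ^ 2) • PS1 (gC α β) z + (2 * psi z * PS1 gP z) • G z) with hf'
  have hψc : ContinuousOn psi (closedBall 0 1) := fun z hz => (psi_deriv hz).continuousWithinAt
  have hGc : ContinuousOn G (closedBall 0 1) := fun z hz => (hGd z hz).continuousWithinAt
  have hψn : ∀ z ∈ closedBall (0 : ℂ) 1, ‖psi z‖ ≤ Cp ∧ ‖PS1 gP z‖ ≤ Cp := fun z hz =>
    psi_le (by simpa using hz)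
  have hQn : ∀ z ∈ closedBall (0 : ℂ) 1, ‖psi z ^ 2 + (τ : ℂ) ^ 2‖ ≤ 2 * Cp ^ 2 := by
    intro z hz
    refine (norm_add_le _ _).trans ?_
    rw [norm_pow, norm_pow, Complex.norm_real, norm_of_nonneg hτ0.le]
    have h1 : ‖psi z‖ ^ 2 ≤ Cp ^ 2 := by gcongr; exact (hψn z hz).1
    have h2 : τ ^ 2 ≤ Cp ^ 2 := by gcongr
    linarith
  have hτ2 : τ ^ 2 ≤ Cp ^ 2 := by gcongr
  have ha1 : ‖a‖ ≤ Cp ^ 2 := ha'.trans (by nlinarith [sq_nonneg τ])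
  have hb1 : ‖b‖ ≤ Cp := hb'.trans (by nlinarith)
  obtain ⟨r1, r2, r3⟩ := disc_regular (f := f) (f' := f') (c := 13 * Cp ^ 2)
    (fun z hz => by
      have h1 := (psi_deriv hz).smul_const (cplx n b)
      have h2 := (((psi_deriv hz).fun_pow 2).add_const ((τ : ℂ) ^ 2)).smul (hGd z hz)
      refine ((h1.const_add (cplx n a)).add h2).congr_deriv ?_
      simp only [hf']
      norm_num)
    (by
      have := PS1_cont gsum
      have := PS1_cont hg
      simp only [hf']
      fun_prop)
    (fun z hz => by
      have h1 : ‖f z‖ ≤ ‖cplx n a‖ + ‖psi z • cplx n b‖ + ‖(psi z ^ 2 + (τ : ℂ) ^ 2) • G z‖ := norm_add₃_le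
      rw [norm_smul, norm_smul, LinearIsometry.norm_map, LinearIsometry.norm_map] at h1
      have h2 : ‖psi z‖ * ‖b‖ ≤ Cp * Cp := by gcongr; exact (hψn z hz).1
      have h3 : ‖psi z ^ 2 + (τ : ℂ) ^ 2‖ * ‖G z‖ ≤ 2 * Cp ^ 2 * 3 := by
        gcongr
        · exact hQn z hz
        · exact (hGn z hz).1
      nlinarith)
    (fun z hz => by
      have h1 : ‖f' z‖ ≤ ‖PS1 gP z • cplx n b‖ + (‖(psi z ^ 2 + (τ : ℂ) ^ 2) • PS1 (gC α β) z‖ +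
        ‖(2 * psi z * PS1 gP z) • G z‖) := (norm_add_le _ _).trans (by gcongr; exact norm_add_le _ _)
      rw [norm_smul, norm_smul, norm_smul, LinearIsometry.norm_map, norm_mul, norm_mul] at h1
      have h2 : ‖PS1 gP z‖ * ‖b‖ ≤ Cp * Cp := by gcongr; exact (hψn z hz).2
      have h3 : ‖psi z ^ 2 + (τ : ℂ) ^ 2‖ * ‖PS1 (gC α β) z‖ ≤ 2 * Cp ^ 2 * 3 := by
        gcongr
        · exact hQn z hz
        · exact (hGn z hz).2
      have h4 : ‖(2 : ℂ)‖ * ‖psi z‖ * ‖PS1 gP z‖ * ‖G z‖ ≤ 2 * Cp * Cp * 3 := by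
        have : ‖(2 : ℂ)‖ = 2 := by simp
        rw [this]
        gcongr
        · exact (hψn z hz).1
        · exact (hψn z hz).2
        · exact (hGn z hz).1
      nlinarith)
  refine ⟨f, r1, r2, r3, ?_, ?_, ?_⟩
  · intro θ hθ
    have hsm := xC_small (a := a) (b := b) (τ := τ) (ρ := ρ) (C := Cp) (σ := sg0) (U := UF e α β) (t := θ)
      hτ0 hτC' (sg0_le θ) B.hρC (hUρ θ) ha' hb'
    refine ⟨xC a b τ sg0 (UF e α β) θ, by linarith [hsm.2], ?_, ?_⟩
    · intro j
      have hU : δ / 2 ≤ UF e α β θ j := by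
        have h1 := (PiLp.norm_apply_le (UF e α β θ - e) j).trans (hUe θ)
        have h2 : (UF e α β θ - e) j = UF e α β θ j - δ := by simp [he]
        rw [h2, Real.norm_eq_abs] at h1
        have := (abs_le.1 h1).1
        linarith
      have hx : xC a b τ sg0 (UF e α β) θ j = (p j).re + sg0 θ * ((p j).im / τ)
        + (sg0 θ ^ 2 + τ ^ 2) * UF e α β θ j := by
        simp [xC, ha, hb]
      rw [hx]
      have h1 := (abs_le.1 (hpj j).1).1
      rw [hM] at h1
      have h2 : |sg0 θ * ((p j).im / τ)| ≤ |sg0 θ| * (δ / 4 * τ) := by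
        rw [abs_mul]
        gcongr
        rw [abs_div, abs_of_pos hτ0, div_le_iff₀ hτ0]
        refine (hpj j).2.trans (le_of_eq ?_)
        rw [hM]; ring
      have h3 := (abs_le.1 h2).1
      have h4 : |sg0 θ| * τ ≤ (sg0 θ ^ 2 + τ ^ 2) := by
        nlinarith [sq_nonneg (|sg0 θ| - τ), sq_abs (sg0 θ), sq_nonneg (|sg0 θ|)]
      have h5 : (sg0 θ ^ 2 + τ ^ 2) * (δ / 2) ≤ (sg0 θ ^ 2 + τ ^ 2) * UF e α β θ j := by gcongr
      have h6 := mul_le_mul_of_nonneg_left h4 (by positivity : 0 ≤ δ / 4)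
      have h7 : 0 ≤ δ / 4 * sg0 θ ^ 2 := by positivity
      nlinarith
    · intro j
      have e1 : f (Complex.exp (θ * Complex.I)) = cplx n (xC a b τ sg0 (UF e α β) θ) +
          Complex.I • cplx n (h (xC a b τ sg0 (UF e α β) θ)) := by
        simp only [hf, psi_arc hθ, hGcirc]
        rw [disc_alg]
        have hQ0 : sg0 θ ^ 2 + τ ^ 2 ≠ 0 := by positivity
        congr 1
        · ext i
          simp [xC]
        · congr 1
          ext i
          have : h (xC a b τ sg0 (UF e α β) θ) = (sg0 θ ^ 2 + τ ^ 2) • yC h a b τ sg0 (UF e α β) θ := by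
            unfold yC
            rw [smul_smul, mul_inv_cancel₀ hQ0, one_smul]
          rw [this]
          simp
      rw [e1]
      simp [mul_comm]
  · have e1 : f 1 = cplx n a + ((τ : ℂ) ^ 2) • G 1 := by simp [hf, psi_one]
    rw [e1]
    refine (norm_add_le _ _).trans ?_
    rw [LinearIsometry.norm_map, norm_smul, norm_pow, Complex.norm_real, norm_of_nonneg hτ0.le]
    have h1 : τ ^ 2 * ‖G 1‖ ≤ (Cp * s) ^ 2 * 3 := by
      gcongr
      exact (hGn 1 (by simp)).1
    nlinarith
  · simp only [hf, hτ]
    have e1 : ((τ : ℂ) * Complex.I) ^ 2 + (τ : ℂ) ^ 2 = 0 := by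
      rw [mul_pow, Complex.I_sq]; ring
    rw [e1, zero_smul, add_zero]
    ext j
    have hτc : (τ : ℂ) ≠ 0 := by exact_mod_cast hτ0.ne'
    simp only [PiLp.add_apply, PiLp.smul_apply, cplx_apply, ha, hb, smul_eq_mul, Complex.ofReal_div]
    have : (τ : ℂ) * Complex.I * (((p j).im : ℂ) / τ) = ((p j).im : ℂ) * Complex.I := by
      field_simp
    rw [this, Complex.re_add_im]

end final

/-- Analytic discs partly attached to the graph of `h` over
the corner `(ℝ⁺)ⁿ`: there are constants `θ₀ ∈ (0,π/2)`, `c₀ > 1` and `r₀ > 0`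
depending only on `(n, c₁)` such that for every `C⁵` map `h` on the closed unit
ball of `ℝⁿ` with `h(0) = 0`, `Dh(0) = 0` and `‖h‖_{C⁵} ≤ c₁`, and every
`p ∈ ℂⁿ` with `0 < |p| < r₀`, there is an analytic disc `f` of class `C¹` on
`𝔻̄` with `‖f‖_{C¹} ≤ c₀`, `[e^{-iθ₀}, e^{iθ₀}]`-attached to
`{x + i h(x) : x ∈ (ℝ⁺)ⁿ ∩ B̄_n(0,1)}`, with `|f(1)| ≤ c₀|p|`, `f(ζ) = p` and
`|1 − ζ| ≤ √(c₀|p|)` for some `ζ ∈ 𝔻`. -/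
theorem stmt_14 (n : ℕ) (hn : 1 ≤ n) (c₁ : ℝ) (hc₁ : 0 < c₁) :
    ∃ θ₀ ∈ Set.Ioo (0 : ℝ) (π / 2), ∃ c₀ > (1 : ℝ), ∃ r₀ > (0 : ℝ),
      ∀ h : EuclideanSpace ℝ (Fin n) → EuclideanSpace ℝ (Fin n),
        ContDiffOn ℝ 5 h (Metric.closedBall (0 : EuclideanSpace ℝ (Fin n)) 1) →
        h 0 = 0 →
        fderivWithin ℝ h (Metric.closedBall (0 : EuclideanSpace ℝ (Fin n)) 1) 0 = 0 →
        CkNormOn 5 (Metric.closedBall (0 : EuclideanSpace ℝ (Fin n)) 1) h ≤ c₁ →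
        ∀ p : EuclideanSpace ℂ (Fin n), p ≠ 0 → ‖p‖ < r₀ →
          ∃ f : ℂ → EuclideanSpace ℂ (Fin n), ∃ ζ ∈ Metric.ball (0 : ℂ) 1,
            DifferentiableOn ℂ f (Metric.ball (0 : ℂ) 1) ∧
            ContDiffOn ℝ 1 f (Metric.closedBall (0 : ℂ) 1) ∧
            CkNormOn 1 (Metric.closedBall (0 : ℂ) 1) f ≤ c₀ ∧
            (∀ θ : ℝ, |θ| ≤ θ₀ →
              ∃ x : EuclideanSpace ℝ (Fin n), ‖x‖ ≤ 1 ∧ (∀ j : Fin n, 0 ≤ x j) ∧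
                ∀ j : Fin n, f (Complex.exp (θ * Complex.I)) j =
                  (x j : ℂ) + (h x j : ℂ) * Complex.I) ∧
            ‖f 1‖ ≤ c₀ * ‖p‖ ∧ f ζ = p ∧ ‖1 - ζ‖ ≤ Real.sqrt (c₀ * ‖p‖) := by
  have hC := Cp_pos
  have hvm := vm_pos
  have hn0 : (0 : ℝ) < n := by exact_mod_cast hn
  set ρ : ℝ := 1 / (12 * Cp ^ 2 + 23 * n * (232 * c₁ * Cp ^ 2)) with hρ
  have hden : 0 < 12 * Cp ^ 2 + 23 * n * (232 * c₁ * Cp ^ 2) := by positivity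
  have hρ0 : 0 < ρ := by positivity
  have hρe : ρ * (12 * Cp ^ 2 + 23 * n * (232 * c₁ * Cp ^ 2)) = 1 := by rw [hρ]; field_simp
  have hρC : 12 * ρ * Cp ^ 2 ≤ 1 := by
    have : 0 ≤ ρ * (23 * n * (232 * c₁ * Cp ^ 2)) := by positivity
    nlinarith
  have hρA : 23 * n * (232 * c₁ * Cp ^ 2) * ρ ≤ 1 := by
    have : 0 ≤ ρ * (12 * Cp ^ 2) := by positivity
    nlinarith
  set δ : ℝ := ρ / (2 * n) with hδ
  have hδ0 : 0 < δ := by positivity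
  set D : ℝ := 64 / (δ * vm ^ 2) with hD
  have hD0 : 0 < D := by positivity
  refine ⟨1, ⟨by norm_num, by linarith [pi_gt_three]⟩, 13 * Cp ^ 2 + D + (1 + 3 * Cp ^ 2 * D),
    by nlinarith [mul_pos hD0 hD0, (by positivity : 0 < Cp ^ 2 * D)], 1 / D, by positivity, ?_⟩
  intro h hh h0 hd0 hnorm p hp0 hpr
  have H := HF_of_C5 hc₁ hh h0 hd0 hnorm
  have hpp : 0 < ‖p‖ := norm_pos_iff.2 hp0
  set s : ℝ := Real.sqrt (D * ‖p‖) with hs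
  have hs0 : 0 < s := Real.sqrt_pos.2 (by positivity)
  have hs2 : s ^ 2 = D * ‖p‖ := Real.sq_sqrt (by positivity)
  have hs1 : s < 1 := by
    rw [lt_div_iff₀ hD0] at hpr
    by_contra hcon
    push Not at hcon
    nlinarith
  obtain ⟨τ, hτ, hτl, hτu⟩ := psi_real hs0 hs1
  have hτ0 : 0 < τ := lt_of_lt_of_le (by positivity) hτl
  have hpτ : ‖p‖ ≤ δ / 4 * τ ^ 2 := by
    have h1 : (vm / 4 * s) ^ 2 ≤ τ ^ 2 := by gcongr
    rw [mul_pow, hs2] at h1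
    calc ‖p‖ = δ / 4 * ((vm / 4) ^ 2 * (D * ‖p‖)) := by rw [hD]; field_simp; norm_num
      _ ≤ _ := by gcongr
  obtain ⟨f, f1, f2, f3, f4, f5, f6⟩ := disc_main hn H hρ0 hρC hρA hδ p hs0 hs1 hτ hτ0 hτu hpτ
  have hCD : 0 < Cp ^ 2 * D := by positivity
  have hC2 : 0 < Cp ^ 2 := by positivity
  refine ⟨f, 1 - s, ?_, f1, f2, f3.trans (by linarith), f4, ?_, f6, ?_⟩
  · rw [mem_ball_zero_iff]
    have : ((1 : ℂ) - s) = ((1 - s : ℝ) : ℂ) := by push_cast; ring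
    rw [this, Complex.norm_real, norm_of_nonneg (by linarith)]
    linarith
  · refine f5.trans ?_
    rw [hs2]
    have : 0 ≤ (13 * Cp ^ 2 + D) * ‖p‖ := by positivity
    nlinarith
  · have : ‖(1 : ℂ) - (1 - s)‖ = s := by
      rw [sub_sub_cancel, Complex.norm_real, norm_of_nonneg hs0.le]
    rw [this, hs]
    apply Real.sqrt_le_sqrt
    gcongr
    linarith
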